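/- Let Ω, Ω' ⊆ ℝⁿ be domains, 1 ≤ q < p < ∞, 1/σ = 1/q − 1/p, and let φ : Ω → Ω' be a homeomorphism inducing a bounded composition operator: there is K ≥ 0 such that for every locally Lipschitz u : Ω' → ℝ with ∫_{Ω'}‖∇u‖^p dx < ∞, the composition u∘φ is locally integrable with weak gradient v_u and (∫_Ω‖v_u‖^q dx)^{1/q} ≤ K·(∫_{Ω'}‖∇u‖^p dx)^{1/p}; let ‖φ*‖ denote the least such K. Then for every open set U ⊆ Ω, ∫_U K_p(x,φ)^σ dx = Φ_{p,q}(φ(U)), where for open V ⊆ Ω', Φ_{p,q}(V) = ( sup{ (∫_Ω‖v_u‖^q dx)^{1/q} / (∫_{Ω'}‖∇u‖^p dx)^{1/p} : u locally Lipschitz on Ω', 0 < ∫_{Ω'}‖∇u‖^p dx < ∞, u = 0 on Ω'∖V } )^σ. In addition, for all 1 ≤ q ≤ p < ∞, ‖K_p(·,φ)‖_{L_σ(Ω)} = ‖φ*‖ (with σ = ∞ when q = p). -/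

import Mathlib

open MeasureTheory Set
open scoped ENNReal Topology NNReal

noncomputable section

/-- `f` has weak gradient `v` on the open set `Ω ⊆ ℝⁿ`. -/
def HasWeakGradOn {n : ℕ} (f : EuclideanSpace ℝ (Fin n) → ℝ)
    (v : EuclideanSpace ℝ (Fin n) → EuclideanSpace ℝ (Fin n))
    (Ω : Set (EuclideanSpace ℝ (Fin n))) : Prop :=
  LocallyIntegrableOn f Ω volume ∧ LocallyIntegrableOn v Ω volume ∧
    ∀ ψ : EuclideanSpace ℝ (Fin n) → ℝ, ContDiff ℝ (⊤ : ℕ∞) ψ → HasCompactSupport ψ →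
      tsupport ψ ⊆ Ω →
      ∫ x in Ω, f x • gradient ψ x = - ∫ x in Ω, ψ x • v x

/-- `u` is Lipschitz on every compact subset of `Ω'`. -/
def LocLipschitzOn {n : ℕ} (u : EuclideanSpace ℝ (Fin n) → ℝ)
    (Ω' : Set (EuclideanSpace ℝ (Fin n))) : Prop :=
  ∀ K : Set (EuclideanSpace ℝ (Fin n)), K ⊆ Ω' → IsCompact K →
    ∃ C : ℝ≥0, LipschitzOnWith C u K

/-- `φ* : L¹_p(Ω') ∩ Lip_loc(Ω') → L¹_q(Ω)` is bounded with norm at most `K`. -/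
def CompBound {n : ℕ} (p q K : ℝ) (φ : EuclideanSpace ℝ (Fin n) → EuclideanSpace ℝ (Fin n))
    (Ω Ω' : Set (EuclideanSpace ℝ (Fin n))) : Prop :=
  ∀ u : EuclideanSpace ℝ (Fin n) → ℝ, LocLipschitzOn u Ω' →
    IntegrableOn (fun x => ‖gradient u x‖ ^ p) Ω' volume →
    ∃ v, HasWeakGradOn (u ∘ φ) v Ω ∧ IntegrableOn (fun x => ‖v x‖ ^ q) Ω volume ∧
      (∫ x in Ω, ‖v x‖ ^ q) ^ (1/q) ≤ K * (∫ x in Ω', ‖gradient u x‖ ^ p) ^ (1/p)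

/-- `D` is the weak Jacobian matrix of `φ` on `Ω`: the `j`-th row of `D` is the weak
gradient of the `j`-th component of `φ`. -/
def IsWeakJacobian {n : ℕ} (φ : EuclideanSpace ℝ (Fin n) → EuclideanSpace ℝ (Fin n))
    (D : EuclideanSpace ℝ (Fin n) → (EuclideanSpace ℝ (Fin n) →L[ℝ] EuclideanSpace ℝ (Fin n)))
    (Ω : Set (EuclideanSpace ℝ (Fin n))) : Prop :=
  ∀ j : Fin n, HasWeakGradOn (fun x => φ x j)
    (fun x => (WithLp.equiv 2 (Fin n → ℝ)).symm (fun i => D x (EuclideanSpace.single i 1) j)) Ω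

/-- The outer distortion function `K_p(·,φ)` built from the weak Jacobian `D`. -/
def distortionFn {n : ℕ} (p : ℝ)
    (D : EuclideanSpace ℝ (Fin n) → (EuclideanSpace ℝ (Fin n) →L[ℝ] EuclideanSpace ℝ (Fin n)))
    (x : EuclideanSpace ℝ (Fin n)) : ℝ :=
  if LinearMap.det ((D x) : EuclideanSpace ℝ (Fin n) →ₗ[ℝ] EuclideanSpace ℝ (Fin n)) ≠ 0 then
    ‖D x‖ / |LinearMap.det ((D x) : EuclideanSpace ℝ (Fin n) →ₗ[ℝ] EuclideanSpace ℝ (Fin n))| ^ (1/p)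
  else 0

/-- The exponent `σ` with `1/σ = 1/q − 1/p`, equal to `∞` when `q = p`. -/
def sigmaExp (p q : ℝ) : ℝ≥0∞ :=
  if q = p then ⊤ else ENNReal.ofReal (1 / (1/q - 1/p))

/-- The set function `Φ_{p,q}` associated to the composition operator
`L¹_p(Ω') ∩ Lip_loc(Ω') → L¹_q(Ω)`, raised to the power `σ`. -/
def PhiPQ {n : ℕ} (p q σ : ℝ) (φ : EuclideanSpace ℝ (Fin n) → EuclideanSpace ℝ (Fin n))
    (Ω Ω' V : Set (EuclideanSpace ℝ (Fin n))) : ℝ :=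
  (sSup {r : ℝ | ∃ (u : EuclideanSpace ℝ (Fin n) → ℝ)
      (v : EuclideanSpace ℝ (Fin n) → EuclideanSpace ℝ (Fin n)),
    LocLipschitzOn u Ω' ∧ (∀ y ∈ Ω' \ V, u y = 0) ∧
    IntegrableOn (fun x => ‖gradient u x‖ ^ p) Ω' volume ∧
    (0 < ∫ x in Ω', ‖gradient u x‖ ^ p) ∧
    HasWeakGradOn (u ∘ φ) v Ω ∧ IntegrableOn (fun x => ‖v x‖ ^ q) Ω volume ∧
    r = (∫ x in Ω, ‖v x‖ ^ q) ^ (1/q) / (∫ x in Ω', ‖gradient u x‖ ^ p) ^ (1/p)}) ^ σ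


section HelperParts
set_option linter.unusedSectionVars false
set_option linter.unusedVariables false
open Filter Metric Convolution

section PartOne
variable {E : Type*} [NormedAddCommGroup E] [InnerProductSpace ℝ E] [FiniteDimensional ℝ E]
  [MeasurableSpace E] [BorelSpace E] {μ : Measure E} [μ.IsAddHaarMeasure]

/-- Mollification of a function by a kernel. -/
def moll (μ : Measure E) (ρ : E → ℝ) (f : E → ℝ) (x : E) : ℝ := ∫ y, ρ (x - y) * f y ∂μ

theorem gradient_sub_left (ρ : E → ℝ) (hρ : Differentiable ℝ ρ) (x y : E) :
    InnerProductSpace.toDual ℝ E (gradient (fun z => ρ (x - z)) y) = - fderiv ℝ ρ (x - y) := by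
  simp only [gradient, LinearIsometryEquiv.apply_symm_apply]
  have h1 : HasFDerivAt (fun z : E => x - z) (-ContinuousLinearMap.id ℝ E) y := by
    simpa using (hasFDerivAt_id y).const_sub x
  have h2 := (hρ (x - y)).hasFDerivAt.comp y h1
  have h3 : fderiv ℝ (fun z => ρ (x - z)) y = (fderiv ℝ ρ (x - y)).comp (-ContinuousLinearMap.id ℝ E) :=
    h2.fderiv
  rw [h3]; ext h; simp

theorem hasFDerivAt_moll (ρ : E → ℝ) (hρ : ContDiff ℝ (⊤ : ℕ∞) ρ) (hρc : HasCompactSupport ρ)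
    (f : E → ℝ) (hf : Continuous f) (v : E → E)
    (hw : ∀ ψ : E → ℝ, ContDiff ℝ (⊤ : ℕ∞) ψ → HasCompactSupport ψ →
      ∫ x, f x • gradient ψ x ∂μ = - ∫ x, ψ x • v x ∂μ) (x : E) :
    HasFDerivAt (moll μ ρ f) (InnerProductSpace.toDual ℝ E (∫ y, ρ (x - y) • v y ∂μ)) x := by
  have h0 : moll μ ρ f = (ρ ⋆[ContinuousLinearMap.lsmul ℝ ℝ, μ] f) := by
    ext x; rw [convolution_eq_swap]; rfl
  have hd : Differentiable ℝ ρ := hρ.differentiable (by simp)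
  have h1 := hρc.hasFDerivAt_convolution_left (μ := μ) (ContinuousLinearMap.lsmul ℝ ℝ)
    (hρ.of_le (by exact_mod_cast le_top)) hf.locallyIntegrable x
  rw [h0]
  convert! h1 using 1
  have hcs : HasCompactSupport (fun z => ρ (x - z)) :=
    hρc.comp_homeomorph (Homeomorph.subLeft x)
  have h2 := hw (fun z => ρ (x - z)) (hρ.comp (contDiff_const.sub contDiff_id)) hcs
  have h3 : ∫ y, ρ (x - y) • v y ∂μ = - ∫ y, f y • gradient (fun z => ρ (x - z)) y ∂μ := by
    rw [h2, neg_neg]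
  rw [h3, map_neg, convolution_eq_swap]
  have h4 := (InnerProductSpace.toDual ℝ E).toContinuousLinearEquiv.integral_comp_comm (μ := μ)
    (fun y => f y • gradient (fun z => ρ (x - z)) y)
  rw [LinearIsometryEquiv.coe_toContinuousLinearEquiv] at h4
  rw [← h4, ← integral_neg]
  congr 1
  ext y h
  have h5 := gradient_sub_left ρ hd x y
  rw [map_smulₛₗ, h5]
  simp [ContinuousLinearMap.precompL_apply, mul_comm]

/-- Bound for the derivative of the mollification. -/
theorem norm_moll_grad_sub_le (ρ : E → ℝ) (hρ : Continuous ρ) (hρc : HasCompactSupport ρ)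
    (hρ0 : ∀ x, 0 ≤ ρ x) (hρ1 : ∫ x, ρ x ∂μ = 1) {r R C : ℝ}
    (hsupp : ∀ x, r ≤ ‖x‖ → ρ x = 0) (hC : ∀ x, ρ x ≤ C / μ.real (closedBall (0:E) R))
    (v : E → E) (hv : LocallyIntegrable v μ) (A z x : E) (hzx : ‖z - x‖ + r ≤ R) :
    ‖(∫ y, ρ (z - y) • v y ∂μ) - A‖ ≤ C * ⨍ y in closedBall x R, ‖v y - A‖ ∂μ := by
  have hcs : HasCompactSupport (fun y => ρ (z - y)) :=
    hρc.comp_homeomorph (Homeomorph.subLeft z)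
  have hcont : Continuous (fun y => ρ (z - y)) := hρ.comp (continuous_const.sub continuous_id)
  have h1 : ∫ y, ρ (z - y) • A ∂μ = A := by
    rw [integral_smul_const, integral_sub_left_eq_self (fun y => ρ y) μ z, hρ1, one_smul]
  have i1 : Integrable (fun y => ρ (z - y) • v y) μ :=
    hv.integrable_smul_left_of_hasCompactSupport hcont hcs
  have i2 : Integrable (fun y => ρ (z - y) • A) μ :=
    (hcont.integrable_of_hasCompactSupport hcs).smul_const A
  have h2 : (∫ y, ρ (z - y) • v y ∂μ) - A = ∫ y, ρ (z - y) • (v y - A) ∂μ := by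
    simp only [smul_sub]
    rw [integral_sub i1 i2, h1]
  rw [h2]
  have hli : IntegrableOn (fun y => ‖v y - A‖) (closedBall x R) μ :=
    ((hv.integrableOn_isCompact (isCompact_closedBall x R)).sub
      (integrableOn_const (isCompact_closedBall x R).measure_lt_top.ne)).norm
  calc ‖∫ y, ρ (z - y) • (v y - A) ∂μ‖ ≤ ∫ y, ‖ρ (z - y) • (v y - A)‖ ∂μ :=
        norm_integral_le_integral_norm _
    _ = ∫ y in closedBall x R, ‖ρ (z - y) • (v y - A)‖ ∂μ := by
        symm
        apply setIntegral_eq_integral_of_forall_compl_eq_zero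
        intro y hy
        rw [hsupp, zero_smul, norm_zero]
        by_contra! hlt
        apply hy
        rw [mem_closedBall, dist_eq_norm]
        calc ‖y - x‖ = ‖(z - x) - (z - y)‖ := by congr 1; abel
          _ ≤ ‖z - x‖ + ‖z - y‖ := norm_sub_le _ _
          _ ≤ R := by linarith
    _ ≤ ∫ y in closedBall x R, (C / μ.real (closedBall (0:E) R)) * ‖v y - A‖ ∂μ := by
        apply integral_mono_of_nonneg
        · exact Eventually.of_forall fun y => norm_nonneg _
        · exact hli.const_mul _
        · refine Eventually.of_forall fun y => ?_
          simp only [norm_smul, Real.norm_eq_abs, abs_of_nonneg (hρ0 _)]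
          exact mul_le_mul_of_nonneg_right (hC _) (norm_nonneg _)
    _ = C * ⨍ y in closedBall x R, ‖v y - A‖ ∂μ := by
        rw [integral_const_mul, setAverage_eq, smul_eq_mul]
        have : μ.real (closedBall x R) = μ.real (closedBall (0:E) R) := by
          simp only [measureReal_def, Measure.addHaar_closedBall_center]
        rw [this]; ring

end PartOne

section PartTwo
variable {E : Type*} [NormedAddCommGroup E] [InnerProductSpace ℝ E] [FiniteDimensional ℝ E]
  [MeasurableSpace E] [BorelSpace E] {μ : Measure E} [μ.IsAddHaarMeasure]

theorem moll_eq (ρ : E → ℝ) (f : E → ℝ) (x : E) :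
    moll μ ρ f x = ∫ w, ρ w * f (x - w) ∂μ := by
  unfold moll
  rw [← integral_sub_left_eq_self (fun y => ρ (x - y) * f y) μ x]
  simp

theorem moll_comm (ρ₁ ρ₂ f : E → ℝ) (h₁ : Continuous ρ₁) (h₂ : Continuous ρ₂)
    (c₁ : HasCompactSupport ρ₁) (c₂ : HasCompactSupport ρ₂) (hf : Continuous f) (x : E) :
    moll μ ρ₂ (moll μ ρ₁ f) x = moll μ ρ₁ (moll μ ρ₂ f) x := by
  have e : ∀ ρ ρ' : E → ℝ, moll μ ρ (moll μ ρ' f) x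
      = ∫ z, ∫ w, ρ z * (ρ' w * f (x - z - w)) ∂μ ∂μ := by
    intro ρ ρ'
    rw [moll_eq]
    congr 1; ext z
    rw [moll_eq, integral_const_mul]
  rw [e, e, integral_integral_swap_of_hasCompactSupport]
  · congr 1; ext w; congr 1; ext z
    rw [sub_right_comm]; ring
  · simp only [Function.uncurry_def]
    fun_prop
  · apply HasCompactSupport.intro (IsCompact.prod c₂ c₁)
    rintro ⟨z, w⟩ hzw
    simp only [Function.uncurry_apply_pair]
    by_cases hz : z ∈ tsupport ρ₂
    · have hw : w ∉ tsupport ρ₁ := fun hw => hzw ⟨hz, hw⟩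
      rw [image_eq_zero_of_notMem_tsupport hw]; ring
    · rw [image_eq_zero_of_notMem_tsupport hz]; ring

theorem abs_moll_sub_le (ρ : E → ℝ) (hρ : Continuous ρ) (hρc : HasCompactSupport ρ)
    (hρ0 : ∀ x, 0 ≤ ρ x) (hρ1 : ∫ x, ρ x ∂μ = 1) (hsymm : ∀ x, ρ (-x) = ρ x) {r c : ℝ}
    (hc : 0 ≤ c)
    (hsupp : ∀ x, r ≤ ‖x‖ → ρ x = 0) (F : E → ℝ) (F' : E → E →L[ℝ] ℝ)
    (hF : ∀ z, HasFDerivAt F (F' z) z) (A : E →L[ℝ] ℝ) (x : E)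
    (hb : ∀ z ∈ closedBall x r, ‖F' z - A‖ ≤ c) : |moll μ ρ F x - F x| ≤ c * r := by
  have hFc : Continuous F := continuous_iff_continuousAt.2 fun z => (hF z).continuousAt
  have hodd : ∫ z, ρ z * A z ∂μ = 0 := by
    have := integral_neg_eq_self (fun z => ρ z * A z) μ
    simp only [hsymm, map_neg, mul_neg, integral_neg] at this
    linarith
  have i1 : Integrable (fun z => ρ z * F (x - z)) μ :=
    (hρ.mul (hFc.comp (continuous_const.sub continuous_id))).integrable_of_hasCompactSupport
      hρc.mul_right
  have i2 : Integrable (fun z => ρ z * F x) μ :=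
    (hρ.integrable_of_hasCompactSupport hρc).mul_const _
  have i3 : Integrable (fun z => ρ z * A z) μ :=
    (hρ.mul A.continuous).integrable_of_hasCompactSupport hρc.mul_right
  have h1 : moll μ ρ F x - F x = ∫ z, ρ z * (F (x - z) - F x - A ((x - z) - x)) ∂μ := by
    have : ∀ z, ρ z * (F (x - z) - F x - A ((x - z) - x))
      = ρ z * F (x - z) - ρ z * F x + ρ z * A z := by
      intro z
      have : x - z - x = - z := by abel
      rw [this, map_neg]; ring
    simp_rw [this]
    have i12 : Integrable (fun z => ρ z * F (x - z) - ρ z * F x) μ := i1.sub i2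
    rw [integral_add i12 i3, integral_sub i1 i2, hodd, integral_mul_const, hρ1, moll_eq]
    ring
  rw [h1, ← Real.norm_eq_abs]
  calc ‖∫ z, ρ z * (F (x - z) - F x - A ((x - z) - x)) ∂μ‖
      ≤ ∫ z, ρ z * (c * r) ∂μ := by
        apply norm_integral_le_of_norm_le ((hρ.integrable_of_hasCompactSupport hρc).mul_const _)
        refine Eventually.of_forall fun z => ?_
        rw [norm_mul, Real.norm_eq_abs, abs_of_nonneg (hρ0 z)]
        by_cases hz : r ≤ ‖z‖
        · rw [hsupp z hz]; simp
        · push Not at hz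
          apply mul_le_mul_of_nonneg_left _ (hρ0 z)
          have hr : 0 ≤ r := (norm_nonneg z).trans hz.le
          have := (convex_closedBall x r).norm_image_sub_le_of_norm_hasFDerivWithin_le'
            (f := F) (f' := F') (φ := A) (C := c) (x := x) (y := x - z)
            (fun y _ => (hF y).hasFDerivWithinAt) hb (mem_closedBall_self hr)
            (by rw [mem_closedBall, dist_eq_norm]; simpa using hz.le)
          refine this.trans ?_
          have : ‖x - z - x‖ = ‖z‖ := by rw [show x - z - x = - z by abel, norm_neg]
          rw [this]
          exact mul_le_mul_of_nonneg_left hz.le hc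
    _ = c * r := by rw [integral_mul_const, hρ1, one_mul]

/-- A dyadic sequence of bump functions. -/
def dyBump (E : Type*) [NormedAddCommGroup E] [InnerProductSpace ℝ E] (j : ℕ) :
    ContDiffBump (0 : E) where
  rIn := (1/2 : ℝ)^j / 2
  rOut := (1/2 : ℝ)^j
  rIn_pos := by positivity
  rIn_lt_rOut := by
    have : (0:ℝ) < (1/2 : ℝ)^j := by positivity
    linarith

/-- Dyadic mollification kernel. -/
def dyK (μ : Measure E) (j : ℕ) : E → ℝ := (dyBump E j).normed μ

theorem dyK_contDiff (j : ℕ) : ContDiff ℝ (⊤ : ℕ∞) (dyK μ j) := ContDiffBump.contDiff_normed _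
theorem dyK_cont (j : ℕ) : Continuous (dyK μ j) := ContDiffBump.continuous_normed _
theorem dyK_comp (j : ℕ) : HasCompactSupport (dyK μ j) := ContDiffBump.hasCompactSupport_normed _
theorem dyK_nonneg (j : ℕ) (x : E) : 0 ≤ dyK μ j x := ContDiffBump.nonneg_normed _ _
theorem dyK_int (j : ℕ) : ∫ x, dyK μ j x ∂μ = 1 := ContDiffBump.integral_normed _
theorem dyK_symm (j : ℕ) (x : E) : dyK μ j (-x) = dyK μ j x := ContDiffBump.normed_neg _ _
theorem dyK_supp (j : ℕ) (x : E) (hx : (1/2 : ℝ)^j ≤ ‖x‖) : dyK μ j x = 0 := by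
  rw [← Function.notMem_support, dyK, ContDiffBump.support_normed_eq]
  simpa [dyBump] using hx

theorem dyK_le (j k : ℕ) (hk : k = j ∨ k = j + 1) (x : E) :
    dyK μ k x ≤ 8 ^ (Module.finrank ℝ E) / μ.real (closedBall (0:E) (2 * (1/2 : ℝ)^j)) := by
  have h1 := (dyBump E k).normed_le_div_measure_closedBall_rIn (μ := μ) x
  refine h1.trans ?_
  have hrin : (dyBump E k).rIn = (1/2 : ℝ)^k / 2 := rfl
  rw [hrin]
  have hpos : (0:ℝ) < (1/2 : ℝ)^k := by positivity
  have hpos' : (0:ℝ) < (1/2 : ℝ)^j := by positivity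
  have e : μ.real (closedBall (0:E) (8 * ((1/2 : ℝ)^k / 2)))
      = 8 ^ (Module.finrank ℝ E) * μ.real (closedBall (0:E) ((1/2 : ℝ)^k / 2)) := by
    rw [measureReal_def, Measure.addHaar_closedBall_mul μ _ (by norm_num) (by positivity),
      ENNReal.toReal_mul, ENNReal.toReal_ofReal (by positivity)]
    rfl
  have hle : 2 * (1/2 : ℝ)^j ≤ 8 * ((1/2 : ℝ)^k / 2) := by
    rcases hk with rfl | rfl
    · linarith
    · rw [pow_succ]; linarith
  have hm : μ.real (closedBall (0:E) (2 * (1/2 : ℝ)^j))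
      ≤ μ.real (closedBall (0:E) (8 * ((1/2 : ℝ)^k / 2))) :=
    measureReal_mono (closedBall_subset_closedBall hle) (isCompact_closedBall _ _).measure_lt_top.ne
  have p1 : 0 < μ.real (closedBall (0:E) (2 * (1/2 : ℝ)^j)) :=
    ENNReal.toReal_pos (measure_closedBall_pos μ _ (by positivity)).ne'
      (isCompact_closedBall _ _).measure_lt_top.ne
  have p2 : 0 < μ.real (closedBall (0:E) ((1/2 : ℝ)^k / 2)) :=
    ENNReal.toReal_pos (measure_closedBall_pos μ _ (by positivity)).ne'
      (isCompact_closedBall _ _).measure_lt_top.ne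
  rw [div_le_div_iff₀ p2 p1]
  linarith

theorem moll_dyK_tendsto (f : E → ℝ) (hf : Continuous f) (x : E) :
    Tendsto (fun j => moll μ (dyK μ j) f x) atTop (𝓝 (f x)) := by
  have := ContDiffBump.convolution_tendsto_right_of_continuous (μ := μ) (φ := fun j => dyBump E j)
    (l := atTop) (g := f) (tendsto_pow_atTop_nhds_zero_of_lt_one (by norm_num) (by norm_num)) hf x
  refine this.congr fun j => ?_
  rw [moll_eq]; rfl

end PartTwo

section PartThree
variable {E : Type*} [NormedAddCommGroup E] [InnerProductSpace ℝ E] [FiniteDimensional ℝ E]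
  [MeasurableSpace E] [BorelSpace E] {μ : Measure E} [μ.IsAddHaarMeasure]

/-- `f` is almost everywhere approximately differentiable on `Ω` with derivative `L`. -/
def ADiff {F : Type*} [NormedAddCommGroup F] [NormedSpace ℝ F] (μ : Measure E)
    (f : E → F) (L : E → E →L[ℝ] F) (Ω : Set E) : Prop :=
  ∃ S : ℕ → Set E, (∀ m, MeasurableSet (S m)) ∧ (∀ m, S m ⊆ Ω) ∧ μ (Ω \ ⋃ m, S m) = 0 ∧
    ∀ m, ∀ x ∈ S m, HasFDerivWithinAt f (L x) (S m) x

theorem leb_grad_bound (f : E → ℝ) (hf : Continuous f) (v : E → E) (hv : LocallyIntegrable v μ)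
    (j k : ℕ) (hk : k = j ∨ k = j + 1) (x z : E)
    (hz : z ∈ closedBall x ((1/2 : ℝ)^j)) :
    ‖InnerProductSpace.toDual ℝ E (∫ y, dyK μ k (z - y) • v y ∂μ)
      - InnerProductSpace.toDual ℝ E (v x)‖ ≤
      8 ^ (Module.finrank ℝ E) * ⨍ y in closedBall x (2 * (1/2 : ℝ)^j), ‖v y - v x‖ ∂μ := by
  rw [← map_sub, LinearIsometryEquiv.norm_map]
  rw [mem_closedBall, dist_eq_norm] at hz
  have hkj : (1/2 : ℝ)^k ≤ (1/2 : ℝ)^j :=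
    pow_le_pow_of_le_one (by norm_num) (by norm_num) (by omega)
  exact norm_moll_grad_sub_le (dyK μ k) (dyK_cont k) (dyK_comp k) (dyK_nonneg k) (dyK_int k)
    (r := (1/2 : ℝ)^k) (dyK_supp k) (dyK_le j k hk) v hv (v x) z x (by linarith)

theorem dyadic_diff_le (f : E → ℝ) (hf : Continuous f) (v : E → E) (hv : LocallyIntegrable v μ)
    (hw : ∀ ψ : E → ℝ, ContDiff ℝ (⊤ : ℕ∞) ψ → HasCompactSupport ψ →
      ∫ x, f x • gradient ψ x ∂μ = - ∫ x, ψ x • v x ∂μ) (j : ℕ) (x : E) :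
    |moll μ (dyK μ j) f x - moll μ (dyK μ (j+1)) f x| ≤
      2 * (8 ^ (Module.finrank ℝ E) * ⨍ y in closedBall x (2 * (1/2 : ℝ)^j), ‖v y - v x‖ ∂μ)
        * (1/2 : ℝ)^j := by
  set c := 8 ^ (Module.finrank ℝ E) * ⨍ y in closedBall x (2 * (1/2 : ℝ)^j), ‖v y - v x‖ ∂μ
  have hc : 0 ≤ c := by
    have := leb_grad_bound f hf v hv j j (Or.inl rfl) x x (mem_closedBall_self (by positivity))
    exact (norm_nonneg _).trans this
  have hd := fun k z => hasFDerivAt_moll (dyK μ k) (dyK_contDiff k) (dyK_comp k) f hf v hw z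
  have h1 := abs_moll_sub_le (μ := μ) (dyK μ (j+1)) (dyK_cont _) (dyK_comp _) (dyK_nonneg _)
    (dyK_int _) (dyK_symm _) (r := (1/2 : ℝ)^j) hc
    (fun x hx => dyK_supp _ x (le_trans
      (pow_le_pow_of_le_one (by norm_num) (by norm_num) (by omega)) hx))
    (moll μ (dyK μ j) f) _ (hd j) (InnerProductSpace.toDual ℝ E (v x)) x
    (fun z hz => leb_grad_bound f hf v hv j j (Or.inl rfl) x z hz)
  have h2 := abs_moll_sub_le (μ := μ) (dyK μ j) (dyK_cont _) (dyK_comp _) (dyK_nonneg _)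
    (dyK_int _) (dyK_symm _) (r := (1/2 : ℝ)^j) hc (dyK_supp _)
    (moll μ (dyK μ (j+1)) f) _ (hd (j+1)) (InnerProductSpace.toDual ℝ E (v x)) x
    (fun z hz => leb_grad_bound f hf v hv j (j+1) (Or.inr rfl) x z hz)
  rw [moll_comm _ _ f (dyK_cont j) (dyK_cont (j+1)) (dyK_comp j) (dyK_comp (j+1)) hf] at h1
  rw [abs_le] at *
  constructor <;> linarith [h1.1, h1.2, h2.1, h2.2]

theorem dyadic_sum_aux (a : ℕ → ℝ) (l δ : ℝ) (hδ : 0 ≤ δ) (J : ℕ)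
    (hlim : Tendsto a atTop (𝓝 l))
    (h : ∀ i, J ≤ i → |a i - a (i+1)| ≤ δ * (1/2 : ℝ)^i) (j : ℕ) (hj : J ≤ j) :
    |a j - l| ≤ 2 * δ * (1/2 : ℝ)^j := by
  have key : ∀ m, |a j - a (j + m)| ≤ 2 * δ * ((1/2 : ℝ)^j - (1/2 : ℝ)^(j+m)) := by
    intro m
    induction m with
    | zero => simp
    | succ m ih =>
      have h2 := h (j+m) (by omega)
      have : a j - a (j + (m+1)) = (a j - a (j+m)) + (a (j+m) - a (j+m+1)) := by
        rw [← add_assoc]; ring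
      rw [this]
      refine (abs_add_le _ _).trans ?_
      have e : (1/2 : ℝ)^(j+(m+1)) = (1/2 : ℝ)^(j+m) / 2 := by
        rw [← add_assoc, pow_succ]; ring
      rw [e]
      linarith
  have hl : Tendsto (fun m => |a j - a (j+m)|) atTop (𝓝 |a j - l|) := by
    apply Tendsto.abs
    apply Tendsto.const_sub
    exact hlim.comp (tendsto_add_atTop_nat j |>.congr fun m => by rw [add_comm])
  refine le_of_tendsto' hl fun m => (key m).trans ?_
  apply mul_le_mul_of_nonneg_left _ (by linarith)
  have : (0:ℝ) < (1/2 : ℝ)^(j+m) := by positivity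
  linarith

theorem beta_tendsto (f : E → ℝ) (hf : Continuous f) (v : E → E) (hv : LocallyIntegrable v μ)
    (hw : ∀ ψ : E → ℝ, ContDiff ℝ (⊤ : ℕ∞) ψ → HasCompactSupport ψ →
      ∫ x, f x • gradient ψ x ∂μ = - ∫ x, ψ x • v x ∂μ) (x : E)
    (hx : Tendsto (fun j : ℕ => ⨍ y in closedBall x (2 * (1/2 : ℝ)^j), ‖v y - v x‖ ∂μ)
      atTop (𝓝 0)) :
    Tendsto (fun j : ℕ => (moll μ (dyK μ j) f x - f x) / (1/2 : ℝ)^j) atTop (𝓝 0) := by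
  have hx2 : Tendsto (fun j : ℕ => 2 * (8 ^ (Module.finrank ℝ E) *
      ⨍ y in closedBall x (2 * (1/2 : ℝ)^j), ‖v y - v x‖ ∂μ)) atTop (𝓝 0) := by
    simpa using (hx.const_mul (8 ^ (Module.finrank ℝ E))).const_mul 2
  rw [Metric.tendsto_atTop]
  intro ε hε
  obtain ⟨J, hJ⟩ := eventually_atTop.1 (hx2.eventually (gt_mem_nhds (show (0:ℝ) < ε/4 by linarith)))
  refine ⟨J, fun j hj => ?_⟩
  have h1 := dyadic_sum_aux (fun j => moll μ (dyK μ j) f x) (f x) (ε/4) (by linarith) J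
    (moll_dyK_tendsto f hf x) (fun i hi => (dyadic_diff_le f hf v hv hw i x).trans
      (mul_le_mul_of_nonneg_right (hJ i hi).le (by positivity))) j hj
  have hp : (0:ℝ) < (1/2 : ℝ)^j := by positivity
  rw [dist_zero_right, Real.norm_eq_abs, abs_div, abs_of_pos hp, div_lt_iff₀ hp]
  refine lt_of_le_of_lt h1 ?_
  have := mul_pos hε hp
  linarith

theorem hasFDerivWithinAt_of_unif (f : E → ℝ) (hf : Continuous f) (v : E → E)
    (hv : LocallyIntegrable v μ)
    (hw : ∀ ψ : E → ℝ, ContDiff ℝ (⊤ : ℕ∞) ψ → HasCompactSupport ψ →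
      ∫ x, f x • gradient ψ x ∂μ = - ∫ x, ψ x • v x ∂μ) (S : Set E)
    (hu : TendstoUniformlyOn (fun (j : ℕ) x => (moll μ (dyK μ j) f x - f x) / (1/2 : ℝ)^j)
      (fun _ => 0) atTop S) (x : E) (hxS : x ∈ S)
    (hx : Tendsto (fun j : ℕ => ⨍ y in closedBall x (2 * (1/2 : ℝ)^j), ‖v y - v x‖ ∂μ)
      atTop (𝓝 0)) :
    HasFDerivWithinAt f (InnerProductSpace.toDual ℝ E (v x)) S x := by
  rw [hasFDerivWithinAt_iff_isLittleO, Asymptotics.isLittleO_iff]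
  intro ε hε
  have hx2 : Tendsto (fun j : ℕ => 8 ^ (Module.finrank ℝ E) *
      ⨍ y in closedBall x (2 * (1/2 : ℝ)^j), ‖v y - v x‖ ∂μ) atTop (𝓝 0) := by
    simpa using (hx.const_mul (8 ^ (Module.finrank ℝ E)))
  have e1 := hx2.eventually (gt_mem_nhds (show (0:ℝ) < ε/2 by linarith))
  have e2 := (Metric.tendstoUniformlyOn_iff.1 hu) (ε/8) (by linarith)
  obtain ⟨J, hJ⟩ := eventually_atTop.1 (e1.and e2)
  have hpJ : (0:ℝ) < (1/2 : ℝ)^J := by positivity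
  filter_upwards [self_mem_nhdsWithin, mem_nhdsWithin_of_mem_nhds (ball_mem_nhds x hpJ)] with y hyS hy
  rcases eq_or_ne y x with rfl | hne
  · simp
  have hpos : 0 < ‖y - x‖ := norm_pos_iff.2 (sub_ne_zero.2 hne)
  rw [mem_ball, dist_eq_norm] at hy
  obtain ⟨j, hj1, hj2⟩ := exists_nat_pow_near_of_lt_one hpos (hy.le.trans
    (pow_le_one₀ (by norm_num) (by norm_num))) (show (0:ℝ) < 1/2 by norm_num) (by norm_num)
  have hjJ : J ≤ j := by
    by_contra! hlt
    have : (1/2:ℝ)^J ≤ (1/2:ℝ)^(j+1) := pow_le_pow_of_le_one (by norm_num) (by norm_num) (by omega)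
    linarith
  obtain ⟨hc, hβ⟩ := hJ j hjJ
  have hp : (0:ℝ) < (1/2 : ℝ)^j := by positivity
  have hβ' : ∀ z ∈ S, |moll μ (dyK μ j) f z - f z| ≤ ε/8 * (1/2 : ℝ)^j := by
    intro z hz
    have := hβ z hz
    rw [dist_zero_left, Real.norm_eq_abs, abs_div, abs_of_pos hp, div_lt_iff₀ hp] at this
    exact this.le
  have hm := (convex_closedBall x ((1/2 : ℝ)^j)).norm_image_sub_le_of_norm_hasFDerivWithin_le'
    (fun z _ => (hasFDerivAt_moll (dyK μ j) (dyK_contDiff j) (dyK_comp j) f hf v hw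
      z).hasFDerivWithinAt)
    (fun z hz => leb_grad_bound f hf v hv j j (Or.inl rfl) x z hz)
    (mem_closedBall_self hp.le) (show y ∈ closedBall x ((1/2 : ℝ)^j) by
      rw [mem_closedBall, dist_eq_norm]; exact hj2)
  have hm2 := hm.trans (mul_le_mul_of_nonneg_right hc.le hpos.le)
  have b1 := hβ' x hxS
  have b2 := hβ' y hyS
  rw [Real.norm_eq_abs] at hm2 ⊢
  rw [pow_succ] at hj1
  have hk : ε/8 * (1/2 : ℝ)^j ≤ ε/4 * ‖y - x‖ := by nlinarith
  rw [abs_le] at *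
  constructor <;> linarith [hm2.1, hm2.2, b1.1, b1.2, b2.1, b2.2]

theorem adiff_global (f : E → ℝ) (hf : Continuous f) (v : E → E)
    (hv : LocallyIntegrable v μ)
    (hw : ∀ ψ : E → ℝ, ContDiff ℝ (⊤ : ℕ∞) ψ → HasCompactSupport ψ →
      ∫ x, f x • gradient ψ x ∂μ = - ∫ x, ψ x • v x ∂μ) :
    ADiff μ f (fun x => InnerProductSpace.toDual ℝ E (v x)) univ := by
  set P : E → Prop := fun x =>
    Tendsto (fun j : ℕ => ⨍ y in closedBall x (2 * (1/2 : ℝ)^j), ‖v y - v x‖ ∂μ) atTop (𝓝 0)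
  have hP : ∀ᵐ x ∂μ, P x := by
    filter_upwards [IsUnifLocDoublingMeasure.ae_tendsto_average_norm_sub (μ := μ) hv 1] with x hx
    refine hx (fun _ => x) (fun j : ℕ => 2 * (1/2 : ℝ)^j) ?_ ?_
    · rw [tendsto_nhdsWithin_iff]
      refine ⟨?_, Eventually.of_forall fun j => by simp⟩
      simpa using (tendsto_pow_atTop_nhds_zero_of_lt_one (r := (1/2:ℝ)) (by norm_num)
        (by norm_num)).const_mul 2
    · exact Eventually.of_forall fun j => mem_closedBall_self (by positivity)
  obtain ⟨G, hGsub, hGm, hGnull⟩ : ∃ G ⊆ {x | P x}, MeasurableSet G ∧ μ Gᶜ = 0 := by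
    refine ⟨(toMeasurable μ {x | ¬ P x})ᶜ, ?_, (measurableSet_toMeasurable _ _).compl, ?_⟩
    · intro x hx
      by_contra h
      exact hx (subset_toMeasurable _ _ h)
    · rw [compl_compl, measure_toMeasurable]; exact hP
  have hmc : ∀ j, Continuous (moll μ (dyK μ j) f) := fun j =>
    continuous_iff_continuousAt.2 fun z =>
      (hasFDerivAt_moll (dyK μ j) (dyK_contDiff j) (dyK_comp j) f hf v hw z).continuousAt
  have heg : ∀ m : ℕ, ∃ t ⊆ ball (0:E) m, MeasurableSet t ∧ μ t ≤ ENNReal.ofReal (1/(m+1)) ∧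
      TendstoUniformlyOn (fun (j : ℕ) x => (moll μ (dyK μ j) f x - f x) / (1/2 : ℝ)^j)
      (fun _ => 0) atTop (ball (0:E) m \ t) := by
    intro m
    apply tendstoUniformlyOn_of_ae_tendsto
    · intro j
      exact (((hmc j).sub hf).div_const _).stronglyMeasurable
    · exact stronglyMeasurable_const
    · exact measurableSet_ball
    · exact measure_ball_lt_top.ne
    · filter_upwards [hP] with x hx _
      exact beta_tendsto f hf v hv hw x hx
    · positivity
  choose t ht1 ht2 ht3 ht4 using heg
  refine ⟨fun m => (ball (0:E) m \ t m) ∩ G, fun m => (measurableSet_ball.diff (ht2 m)).inter hGm,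
    fun m => subset_univ _, ?_, ?_⟩
  · have hsub : univ \ ⋃ m : ℕ, (ball (0:E) m \ t m) ∩ G ⊆
        Gᶜ ∪ ⋃ N : ℕ, ⋂ m : ℕ, {x | N ≤ m → x ∈ t m} := by
      intro x hx
      by_cases hG : x ∈ G
      · right
        obtain ⟨N, hN⟩ := exists_nat_gt ‖x‖
        refine mem_iUnion.2 ⟨N, mem_iInter.2 fun m hm => ?_⟩
        by_contra hxt
        apply hx.2
        refine mem_iUnion.2 ⟨m, ⟨⟨?_, hxt⟩, hG⟩⟩
        rw [mem_ball_zero_iff]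
        exact hN.trans_le (by exact_mod_cast hm)
      · left; exact hG
    refine measure_mono_null hsub (measure_union_null hGnull (measure_iUnion_null fun N => ?_))
    have hlim : Tendsto (fun m : ℕ => ENNReal.ofReal (1/((m:ℝ)+1))) atTop (𝓝 0) := by
      have := ENNReal.tendsto_ofReal (tendsto_one_div_add_atTop_nhds_zero_nat (𝕜 := ℝ))
      simpa using this
    refine le_antisymm (ge_of_tendsto hlim ?_) bot_le
    filter_upwards [eventually_ge_atTop N] with m hm
    refine le_trans (measure_mono ?_) (ht3 m)
    intro x hx
    exact mem_iInter.1 hx m hm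
  · rintro m x ⟨hx1, hx2⟩
    refine (hasFDerivWithinAt_of_unif f hf v hv hw _ (ht4 m) x hx1 (hGsub hx2)).mono
      inter_subset_left

end PartThree

section PartFour

theorem ADiff.of_countable {E : Type*} [NormedAddCommGroup E] [InnerProductSpace ℝ E]
    [MeasurableSpace E] {μ : Measure E} {F : Type*} [NormedAddCommGroup F] [NormedSpace ℝ F]
    {f : E → F} {L : E → E →L[ℝ] F} {Ω : Set E} {ι : Type*} [Countable ι] (S : ι → Set E)
    (h1 : ∀ m, MeasurableSet (S m)) (h2 : ∀ m, S m ⊆ Ω) (h3 : μ (Ω \ ⋃ m, S m) = 0)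
    (h4 : ∀ m, ∀ x ∈ S m, HasFDerivWithinAt f (L x) (S m) x) : ADiff μ f L Ω := by
  rcases isEmpty_or_nonempty ι with hι | hι
  · refine ⟨fun _ => ∅, fun _ => .empty, fun _ => empty_subset _, ?_, fun _ x hx => hx.elim⟩
    simpa using h3
  · obtain ⟨g, hg⟩ := exists_surjective_nat ι
    refine ⟨fun m => S (g m), fun m => h1 _, fun m => h2 _, ?_, fun m => h4 _⟩
    rwa [hg.iUnion_comp S]

variable {n : ℕ}
local notation "𝔼" => EuclideanSpace ℝ (Fin n)

theorem gradient_mul' (χ ψ : 𝔼 → ℝ) (h1 : Differentiable ℝ χ) (h2 : Differentiable ℝ ψ) (x : 𝔼) :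
    gradient (fun x => χ x * ψ x) x = χ x • gradient ψ x + ψ x • gradient χ x := by
  simp only [gradient]
  rw [fderiv_fun_mul (h1 x) (h2 x), map_add]
  simp

theorem continuous_gradient' (χ : 𝔼 → ℝ) (h1 : ContDiff ℝ (⊤ : ℕ∞) χ) :
    Continuous (gradient χ) := by
  have := h1.continuous_fderiv (by simp)
  exact (InnerProductSpace.toDual ℝ 𝔼).symm.continuous.comp this

theorem gradient_eq_zero_of_notMem_tsupport (χ : 𝔼 → ℝ) (x : 𝔼) (hx : x ∉ tsupport χ) :
    gradient χ x = 0 := by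
  simp only [gradient]
  rw [show fderiv ℝ χ x = 0 from image_eq_zero_of_notMem_tsupport
    (fun h => hx (tsupport_fderiv_subset ℝ h)), map_zero]

theorem localize (f : 𝔼 → ℝ) (v : 𝔼 → 𝔼) (Ω : Set 𝔼) (hΩ : IsOpen Ω)
    (hf : ContinuousOn f Ω) (hw : HasWeakGradOn f v Ω) (χ : 𝔼 → ℝ)
    (hχ : ContDiff ℝ (⊤ : ℕ∞) χ) (hχc : HasCompactSupport χ) (hχs : tsupport χ ⊆ Ω) :
    ADiff volume (fun x => χ x * f x)
      (fun x => InnerProductSpace.toDual ℝ 𝔼 (χ x • v x + f x • gradient χ x)) univ := by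
  obtain ⟨hfi, hvi, hw⟩ := hw
  have hχd : Differentiable ℝ χ := hχ.differentiable (by simp)
  -- multiplication of `f` by a continuous function vanishing off `tsupport χ`
  have hcont : ∀ {G : Type} [NormedAddCommGroup G] [NormedSpace ℝ G] (g : 𝔼 → G), Continuous g →
      tsupport g ⊆ tsupport χ → Continuous (fun x => f x • g x) := by
    intro G _ _ g hg hgs
    rw [continuous_iff_continuousAt]
    intro x
    by_cases hx : x ∈ tsupport χ
    · exact ((hf x (hχs hx)).continuousAt (hΩ.mem_nhds (hχs hx))).smul hg.continuousAt
    · have : (fun x => f x • g x) =ᶠ[𝓝 x] fun _ => 0 := by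
        filter_upwards [(isClosed_tsupport χ).isOpen_compl.mem_nhds hx] with y hy
        rw [image_eq_zero_of_notMem_tsupport (fun h => hy (hgs h)), smul_zero]
      exact continuousAt_const.congr this.symm
  have hcf : Continuous (fun x => χ x * f x) := by
    have := hcont χ hχ.continuous subset_rfl
    simpa [mul_comm] using this
  have hgs : tsupport (gradient χ) ⊆ tsupport χ := by
    apply closure_minimal _ (isClosed_tsupport χ)
    intro x hx
    by_contra h
    exact hx (gradient_eq_zero_of_notMem_tsupport χ x h)
  have hcg : Continuous (fun x => f x • gradient χ x) := hcont _ (continuous_gradient' χ hχ) hgs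
  have hvK : IntegrableOn v (tsupport χ) :=
    hvi.integrableOn_compact_subset hχs hχc
  have hiv : ∀ g : 𝔼 → ℝ, Continuous g → tsupport g ⊆ tsupport χ →
      Integrable (fun x => g x • v x) := by
    intro g hg hgs
    have h1 : IntegrableOn (fun x => g x • v x) (tsupport χ) :=
      hvK.continuousOn_smul hg.continuousOn hχc
    rw [← integrableOn_iff_integrable_of_support_subset (s := tsupport χ)]
    · exact h1
    · intro x hx
      by_contra h
      apply hx
      simp [image_eq_zero_of_notMem_tsupport (fun h' => h (hgs h'))]
  refine adiff_global _ hcf _ ((hiv χ hχ.continuous subset_rfl).locallyIntegrable.add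
    hcg.locallyIntegrable) ?_
  intro ψ hψ hψc
  have hψd : Differentiable ℝ ψ := hψ.differentiable (by simp)
  have hprod_s : tsupport (fun x => χ x * ψ x) ⊆ tsupport χ :=
    closure_mono (Function.support_mul_subset_left χ ψ)
  have h := hw (fun x => χ x * ψ x) (hχ.mul hψ) (hχc.mul_right) (hprod_s.trans hχs)
  have e1 : ∫ x in Ω, f x • gradient (fun x => χ x * ψ x) x
      = ∫ x, f x • gradient (fun x => χ x * ψ x) x := by
    apply setIntegral_eq_integral_of_forall_compl_eq_zero
    intro x hx
    rw [gradient_eq_zero_of_notMem_tsupport _ _ (fun h => hx (hχs (hprod_s h))), smul_zero]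
  have e2 : ∫ x in Ω, (χ x * ψ x) • v x = ∫ x, (χ x * ψ x) • v x := by
    apply setIntegral_eq_integral_of_forall_compl_eq_zero
    intro x hx
    rw [image_eq_zero_of_notMem_tsupport (fun h => hx (hχs h)), zero_mul, zero_smul]
  rw [e1, e2] at h
  have i1 : Integrable (fun x => (χ x * f x) • gradient ψ x) := by
    apply (hcf.smul (continuous_gradient' ψ hψ)).integrable_of_hasCompactSupport
    exact HasCompactSupport.smul_right (HasCompactSupport.mul_right hχc)
  have i2 : Integrable (fun x => ψ x • f x • gradient χ x) := by
    apply (hψ.continuous.smul hcg).integrable_of_hasCompactSupport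
    exact HasCompactSupport.smul_right hψc
  have i3 : Integrable (fun x => (χ x * ψ x) • v x) := hiv _ (hχ.continuous.mul hψ.continuous) hprod_s
  have e3 : ∫ x, f x • gradient (fun x => χ x * ψ x) x
      = (∫ x, (χ x * f x) • gradient ψ x) + ∫ x, ψ x • f x • gradient χ x := by
    rw [← integral_add i1 i2]
    congr 1; ext1 x
    rw [gradient_mul' χ ψ hχd hψd]
    module
  have e4 : ∫ x, ψ x • (χ x • v x + f x • gradient χ x)
      = (∫ x, (χ x * ψ x) • v x) + ∫ x, ψ x • f x • gradient χ x := by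
    rw [← integral_add i3 i2]
    congr 1; ext1 x
    module
  rw [e4, neg_add, ← h, e3]
  abel

theorem adiff_of_weakGrad (f : 𝔼 → ℝ) (v : 𝔼 → 𝔼) (Ω : Set 𝔼) (hΩ : IsOpen Ω)
    (hf : ContinuousOn f Ω) (hw : HasWeakGradOn f v Ω) :
    ADiff volume f (fun x => InnerProductSpace.toDual ℝ 𝔼 (v x)) Ω := by
  have hloc : ∀ x : Ω, ∃ R : ℝ, 0 < R ∧ closedBall x.1 (2 * R) ⊆ Ω := by
    intro x
    obtain ⟨ε, hε, h⟩ := Metric.isOpen_iff.1 hΩ x.1 x.2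
    refine ⟨ε/3, by positivity, (closedBall_subset_ball (by linarith)).trans h⟩
  choose R hR hRΩ using hloc
  let b : ∀ x : Ω, ContDiffBump x.1 := fun x => ⟨R x, 2 * R x, hR x, by linarith [hR x]⟩
  have hbs : ∀ x : Ω, tsupport (b x) ⊆ Ω := by
    intro x; rw [(b x).tsupport_eq]; exact hRΩ x
  have hA := fun x : Ω => localize f v Ω hΩ hf hw (b x) (b x).contDiff (b x).hasCompactSupport (hbs x)
  choose S hSm _ hSn hSd using hA
  obtain ⟨T, hTc, hT⟩ := TopologicalSpace.isOpen_iUnion_countable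
    (fun x : Ω => ball x.1 (R x)) (fun x => isOpen_ball)
  have : Countable T := hTc.to_subtype
  refine ADiff.of_countable (ι := T × ℕ) (fun i => S i.1.1 i.2 ∩ ball i.1.1.1 (R i.1.1)) ?_ ?_ ?_ ?_
  · intro i; exact (hSm _ _).inter measurableSet_ball
  · intro i
    exact inter_subset_right.trans ((ball_subset_closedBall.trans
      (closedBall_subset_closedBall (by linarith [hR i.1.1]))).trans (hRΩ i.1.1))
  · refine measure_mono_null (t := ⋃ i : T, univ \ ⋃ m, S i.1 m) ?_
      (measure_iUnion_null fun i => hSn i.1)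
    rintro x ⟨hxΩ, hx⟩
    have hx' : x ∈ ⋃ x : Ω, ball x.1 (R x) := mem_iUnion.2 ⟨⟨x, hxΩ⟩, mem_ball_self (hR _)⟩
    rw [← hT] at hx'
    simp only [mem_iUnion] at hx'
    obtain ⟨i, hiT, hxi⟩ := hx'
    refine mem_iUnion.2 ⟨⟨i, hiT⟩, mem_univ _, fun hxS => hx ?_⟩
    obtain ⟨m, hm⟩ := mem_iUnion.1 hxS
    exact mem_iUnion.2 ⟨(⟨i, hiT⟩, m), hm, hxi⟩
  · rintro ⟨i, m⟩ x ⟨hxS, hxb⟩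
    have h1 := (hSd i.1 m x hxS).mono (inter_subset_left (t := ball i.1.1 (R i.1)))
    have hev : (b i.1 : 𝔼 → ℝ) =ᶠ[𝓝 x] fun _ => 1 := by
      filter_upwards [isOpen_ball.mem_nhds hxb] with y hy
      exact (b i.1).one_of_mem_closedBall (ball_subset_closedBall hy)
    have hg : gradient (b i.1) x = 0 := by
      simp only [gradient]
      rw [hev.fderiv_eq]; simp
    have h1x : b i.1 x = 1 := hev.self_of_nhds
    beta_reduce at h1
    rw [hg, h1x, one_smul, smul_zero, add_zero] at h1
    refine h1.congr (fun y hy => ?_) ?_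
    · beta_reduce; rw [(b i.1).one_of_mem_closedBall (ball_subset_closedBall hy.2), one_mul]
    · beta_reduce; rw [h1x, one_mul]

/-- A function vanishing on a measurable set has zero derivative a.e. on it. -/
theorem ae_eq_zero_of_deriv_zero (hn : 0 < n) (T : Set 𝔼) (hT : MeasurableSet T) (L : 𝔼 → 𝔼 →L[ℝ] ℝ)
    (h : ∀ x ∈ T, HasFDerivWithinAt (fun _ : 𝔼 => (0:ℝ)) (L x) T x) :
    ∀ᵐ x ∂(volume.restrict T), L x = 0 := by
  set e : 𝔼 := EuclideanSpace.single ⟨0, hn⟩ 1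
  have he : ‖e‖ = 1 := by simp [e]
  have h2 : ApproximatesLinearOn (fun _ : 𝔼 => (0 : 𝔼)) (0 : 𝔼 →L[ℝ] 𝔼) T 0 := by
    intro x _ y _; simp
  have h3 := h2.norm_fderiv_sub_le volume hT (fun x => (L x).smulRight e) (by
    intro x hx
    simpa using (h x hx).smul_const e)
  filter_upwards [h3] with x hx
  have : ‖(L x).smulRight e‖₊ = 0 := by simpa using hx
  rw [nnnorm_eq_zero] at this
  ext y
  have h5 := congrArg (fun M : 𝔼 →L[ℝ] 𝔼 => ‖M y‖) this
  simpa [norm_smul, he] using h5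

theorem ADiff.unique (hn : 0 < n) {f : 𝔼 → ℝ} {L : 𝔼 → 𝔼 →L[ℝ] ℝ} {Ω : Set 𝔼}
    (hf : ADiff volume f L Ω) (T : Set 𝔼) (hT : MeasurableSet T) (M : 𝔼 → 𝔼 →L[ℝ] ℝ)
    (g : 𝔼 → ℝ) (hfg : ∀ x ∈ T, f x = g x)
    (h : ∀ x ∈ T, HasFDerivWithinAt g (M x) T x) :
    ∀ᵐ x, x ∈ T ∩ Ω → L x = M x := by
  obtain ⟨S, hSm, hSΩ, hSn, hSd⟩ := hf
  have h1 : ∀ m, ∀ᵐ x, x ∈ S m ∩ T → L x = M x := by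
    intro m
    have hm := ((hSm m).inter hT)
    rw [← ae_restrict_iff' hm]
    have := ae_eq_zero_of_deriv_zero hn (S m ∩ T) hm (fun x => L x - M x) (by
      rintro x ⟨hx1, hx2⟩
      have a := (hSd m x hx1).mono (inter_subset_left (t := T))
      have b := (h x hx2).mono (inter_subset_right (s := S m))
      have b' := b.congr (fun y hy => hfg y hy.2) (hfg x hx2)
      simpa using a.fun_sub b')
    filter_upwards [this] with x hx using sub_eq_zero.1 hx
  have h2 : ∀ᵐ x, x ∉ Ω \ ⋃ m, S m := measure_eq_zero_iff_ae_notMem.1 hSn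
  filter_upwards [ae_all_iff.2 h1, h2] with x hx hx2 hxT
  have : x ∈ ⋃ m, S m := by
    by_contra h'
    exact hx2 ⟨hxT.2, h'⟩
  obtain ⟨m, hm⟩ := mem_iUnion.1 this
  exact hx m ⟨hm, hxT.1⟩

end PartFour

section PartFive
variable {n : ℕ}
local notation "𝔼" => EuclideanSpace ℝ (Fin n)

/-- A decomposition of `Ω` into countably many measurable pieces (up to a null set) on which
`φ` is differentiable (within the piece) with derivative `D`. -/
structure GoodD (φ : EuclideanSpace ℝ (Fin n) → EuclideanSpace ℝ (Fin n))
    (D : EuclideanSpace ℝ (Fin n) → EuclideanSpace ℝ (Fin n) →L[ℝ] EuclideanSpace ℝ (Fin n))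
    (Ω : Set (EuclideanSpace ℝ (Fin n))) (S : ℕ → Set (EuclideanSpace ℝ (Fin n))) : Prop where
  meas : ∀ m, MeasurableSet (S m)
  disj : Pairwise (Function.onFun Disjoint S)
  sub : ∀ m, S m ⊆ Ω
  null : volume (Ω \ ⋃ m, S m) = 0
  deriv : ∀ m, ∀ x ∈ S m, HasFDerivWithinAt φ (D x) (S m) x
  measD : Measurable D

theorem exists_good (φ : 𝔼 → 𝔼) (D : 𝔼 → 𝔼 →L[ℝ] 𝔼) (Ω : Set 𝔼) (hΩ : IsOpen Ω)
    (hcont : ContinuousOn φ Ω) (hD : IsWeakJacobian φ D Ω) :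
    ∃ D' S, GoodD φ D' Ω S ∧ ∀ᵐ x ∂(volume.restrict Ω), D x = D' x := by
  have hA : ∀ j : Fin n, ADiff volume (fun x => φ x j) (fun x => PiLp.proj 2 (fun _ : Fin n => ℝ) j ∘L D x) Ω := by
    intro j
    have := adiff_of_weakGrad (fun x => φ x j) _ Ω hΩ
      ((EuclideanSpace.proj (𝕜 := ℝ) j).continuous.comp_continuousOn hcont) (hD j)
    convert this using 2 with x
    ext y
    simp only [InnerProductSpace.toDual_apply_apply]
    have hy : y = ∑ i, y i • EuclideanSpace.single i (1:ℝ) := by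
      ext k
      simp [Finset.sum_apply, Pi.single_apply]
    conv_lhs => rw [hy]
    simp only [map_sum, map_smul]
    simp [PiLp.inner_apply]
  choose S hSm hSΩ hSn hSd using hA
  have hfull : ADiff volume φ D Ω := by
    refine ADiff.of_countable (ι := Fin n → ℕ) (fun i => Ω ∩ ⋂ j, S j (i j)) ?_ ?_ ?_ ?_
    · exact fun i => hΩ.measurableSet.inter (MeasurableSet.iInter fun j => hSm j _)
    · exact fun i => inter_subset_left
    · refine measure_mono_null (t := ⋃ j, Ω \ ⋃ m, S j m) ?_ (measure_iUnion_null fun j => hSn j)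
      rintro x ⟨hxΩ, hx⟩
      by_contra h
      simp only [mem_iUnion, Set.mem_sdiff, not_exists, not_and] at h
      have h' : ∀ j, ∃ m, x ∈ S j m := fun j => by simpa using h j hxΩ
      choose i hi using h'
      exact hx (mem_iUnion.2 ⟨i, hxΩ, mem_iInter.2 hi⟩)
    · rintro i x ⟨hxΩ, hx⟩
      rw [hasFDerivWithinAt_euclidean]
      intro j
      exact (hSd j (i j) x (mem_iInter.1 hx j)).mono
        (inter_subset_right.trans (iInter_subset _ j))
  clear hSd hSn hSΩ hSm S
  obtain ⟨S, hSm, hSΩ, hSn, hSd⟩ := hfull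
  have hDm : AEMeasurable D (volume.restrict (⋃ m, S m)) := by
    rw [aemeasurable_iUnion_iff]
    intro m
    exact aemeasurable_fderivWithin volume (hSm m) (hSd m)
  set D' := hDm.mk D
  have hD'm : Measurable D' := hDm.measurable_mk
  have hD' : ∀ᵐ x, x ∈ (⋃ m, S m) → D x = D' x := by
    rw [← ae_restrict_iff' (MeasurableSet.iUnion hSm)]
    exact hDm.ae_eq_mk
  set N := toMeasurable volume {x | ¬ (x ∈ (⋃ m, S m) → D x = D' x)}
  have hN : volume N = 0 := by rw [measure_toMeasurable]; exact hD'
  have hNc : ∀ x, x ∉ N → x ∈ (⋃ m, S m) → D x = D' x := by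
    intro x hx
    by_contra h
    exact hx (subset_toMeasurable _ _ h)
  refine ⟨D', fun m => disjointed S m \ N, ⟨?_, ?_, ?_, ?_, ?_, hD'm⟩, ?_⟩
  · exact fun m => (MeasurableSet.disjointed hSm m).diff (measurableSet_toMeasurable _ _)
  · intro i j hij
    exact (disjoint_disjointed S hij).mono sdiff_subset sdiff_subset
  · exact fun m => sdiff_subset.trans ((disjointed_subset S m).trans (hSΩ m))
  · refine measure_mono_null (t := (Ω \ ⋃ m, S m) ∪ N) ?_ (measure_union_null hSn hN)
    rw [← iUnion_sdiff, iUnion_disjointed]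
    rintro x ⟨h1, h2⟩
    by_cases hxN : x ∈ N
    · exact Or.inr hxN
    · exact Or.inl ⟨h1, fun h => h2 ⟨h, hxN⟩⟩
  · rintro m x ⟨hx, hxN⟩
    have := disjointed_subset S m hx
    rw [← hNc x hxN (mem_iUnion.2 ⟨m, this⟩)]
    exact (hSd m x this).mono (sdiff_subset.trans (disjointed_subset S m))
  · rw [ae_restrict_iff' hΩ.measurableSet]
    filter_upwards [hD', measure_eq_zero_iff_ae_notMem.1 hSn] with x hx hx2 hxΩ
    apply hx
    by_contra h
    exact hx2 ⟨hxΩ, h⟩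

variable {φ : EuclideanSpace ℝ (Fin n) → EuclideanSpace ℝ (Fin n)}
  {D : EuclideanSpace ℝ (Fin n) → EuclideanSpace ℝ (Fin n) →L[ℝ] EuclideanSpace ℝ (Fin n)}
  {Ω : Set (EuclideanSpace ℝ (Fin n))} {S : ℕ → Set (EuclideanSpace ℝ (Fin n))}

theorem GoodD.ae_mem (h : GoodD φ D Ω S) : ∀ᵐ x, x ∈ Ω → x ∈ ⋃ m, S m := by
  filter_upwards [measure_eq_zero_iff_ae_notMem.1 h.null] with x hx hxΩ
  by_contra h
  exact hx ⟨hxΩ, h⟩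

theorem GoodD.area_eq (h : GoodD φ D Ω S) (hinj : InjOn φ Ω) (E : Set 𝔼) (hE : MeasurableSet E)
    (hES : E ⊆ ⋃ m, S m) (g : 𝔼 → ℝ≥0∞) :
    ∫⁻ y in φ '' E, g y = ∫⁻ x in E, ENNReal.ofReal |(D x).det| * g (φ x) := by
  have e1 : E = ⋃ m, E ∩ S m := by rw [← inter_iUnion]; exact (inter_eq_left.2 hES).symm
  have hm : ∀ m, MeasurableSet (E ∩ S m) := fun m => hE.inter (h.meas m)
  have hd : ∀ m, ∀ x ∈ E ∩ S m, HasFDerivWithinAt φ (D x) (E ∩ S m) x :=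
    fun m x hx => (h.deriv m x hx.2).mono inter_subset_right
  have hi : ∀ m, InjOn φ (E ∩ S m) := fun m => hinj.mono (inter_subset_right.trans (h.sub m))
  have hdis : Pairwise (Function.onFun Disjoint fun m => E ∩ S m) := fun i j hij =>
    (h.disj hij).mono inter_subset_right inter_subset_right
  have e2 : φ '' E = ⋃ m, φ '' (E ∩ S m) := by rw [← image_iUnion, ← e1]
  rw [e2, lintegral_iUnion (fun m => measurable_image_of_fderivWithin (hm m) (hd m) (hi m))]
  · conv_rhs => rw [e1]
    rw [lintegral_iUnion hm hdis]
    congr 1; ext1 m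
    exact lintegral_image_eq_lintegral_abs_det_fderiv_mul volume (hm m) (hd m) (hi m) g
  · intro i j hij
    exact disjoint_image_image fun x hx y hy hxy => by
      have := hinj (h.sub _ hx.2) (h.sub _ hy.2) hxy
      subst this
      exact Set.disjoint_left.1 (h.disj hij) hx.2 hy.2

theorem GoodD.volume_image (h : GoodD φ D Ω S) (hinj : InjOn φ Ω) (E : Set 𝔼)
    (hE : MeasurableSet E) (hES : E ⊆ ⋃ m, S m) :
    volume (φ '' E) = ∫⁻ x in E, ENNReal.ofReal |(D x).det| := by
  have := h.area_eq hinj E hE hES (fun _ => 1)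
  simpa using this

theorem GoodD.area_le (h : GoodD φ D Ω S) (hinj : InjOn φ Ω) (E : Set 𝔼) (hE : MeasurableSet E)
    (hEΩ : E ⊆ Ω) (g : 𝔼 → ℝ≥0∞) :
    ∫⁻ x in E, ENNReal.ofReal |(D x).det| * g (φ x) ≤ ∫⁻ y in φ '' E, g y := by
  have hE' : (E ∩ ⋃ m, S m : Set 𝔼) =ᵐ[volume] E := by
    filter_upwards [h.ae_mem] with x hx
    apply propext
    exact ⟨fun h => h.1, fun h => ⟨h, hx (hEΩ h)⟩⟩
  rw [← setLIntegral_congr hE', ← h.area_eq hinj _ (hE.inter (MeasurableSet.iUnion h.meas))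
    inter_subset_right]
  exact lintegral_mono_set (image_mono inter_subset_left)

end PartFive

section PartSix
variable {n : ℕ}
local notation "𝔼" => EuclideanSpace ℝ (Fin n)

/-- distance to the nearest integer -/
def saw (t : ℝ) : ℝ := |t - round t|

theorem abs_saw_sub_le (s t : ℝ) : |saw s - saw t| ≤ |s - t| := by
  have key : ∀ s t : ℝ, saw s ≤ saw t + |s - t| := by
    intro s t
    calc saw s ≤ |s - round t| := round_le s _
      _ = |(t - round t) + (s - t)| := by congr 1; ring
      _ ≤ saw t + |s - t| := abs_add_le _ _
  rw [abs_le]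
  have h1 := key s t
  have h2 := key t s
  rw [abs_sub_comm] at h2
  constructor <;> linarith

theorem saw_nonneg (t : ℝ) : 0 ≤ saw t := abs_nonneg _

theorem saw_le (t : ℝ) : saw t ≤ 1 := (abs_sub_round t).trans (by norm_num)

/-- the sawtooth in direction `a` at scale `d` -/
def hfun (a : EuclideanSpace ℝ (Fin n)) (d : ℝ) (y : EuclideanSpace ℝ (Fin n)) : ℝ :=
  d ^ 2 * saw (inner ℝ a y / d ^ 2)

open Classical in
/-- truncated sawtooth -/
def wfun (F : Set (EuclideanSpace ℝ (Fin n))) (a : EuclideanSpace ℝ (Fin n)) (d : ℝ)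
    (y : EuclideanSpace ℝ (Fin n)) : ℝ :=
  if F.Nonempty then min (hfun a d y) (d * max (d - infDist y F) 0) else 0

theorem hfun_lip (a : 𝔼) {d : ℝ} (hd : 0 < d) : LipschitzWith ‖a‖₊ (hfun a d) := by
  apply LipschitzWith.of_dist_le_mul
  intro x y
  rw [Real.dist_eq, hfun, hfun, ← mul_sub, abs_mul, abs_of_pos (by positivity : 0 < d ^ 2), coe_nnnorm,
    dist_eq_norm]
  calc d ^ 2 * |saw (inner ℝ a x / d ^ 2) - saw (inner ℝ a y / d ^ 2)|
      ≤ d ^ 2 * |inner ℝ a x / d ^ 2 - inner ℝ a y / d ^ 2| := by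
        exact mul_le_mul_of_nonneg_left (abs_saw_sub_le _ _) (by positivity)
    _ = |inner ℝ a (x - y)| := by
        rw [← sub_div, abs_div, abs_of_pos (by positivity : 0 < d ^ 2), inner_sub_right]
        field_simp
    _ ≤ _ := abs_real_inner_le_norm _ _

theorem wfun_lip (F : Set 𝔼) (a : 𝔼) {d : ℝ} (hd : 0 < d) :
    LipschitzWith (‖a‖₊ + d.toNNReal) (wfun F a d) := by
  unfold wfun
  split_ifs with hF
  · have h1 : LipschitzWith d.toNNReal (fun y => d * max (d - infDist y F) 0) := by
      have h2 : LipschitzWith 1 (fun y => max (d - infDist y F) 0) := by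
        apply LipschitzWith.max_const
        have := (LipschitzWith.const (α := 𝔼) d).sub (lipschitz_infDist_pt F)
        simpa using this
      apply LipschitzWith.of_dist_le_mul
      intro x y
      have := h2.dist_le_mul x y
      rw [Real.dist_eq] at this ⊢
      rw [← mul_sub, abs_mul, abs_of_pos hd, Real.coe_toNNReal _ hd.le]
      gcongr
      simpa using this
    refine ((hfun_lip a hd).min h1).weaken ?_
    exact max_le (le_add_of_nonneg_right zero_le) (le_add_of_nonneg_left zero_le)
  · exact (LipschitzWith.const (α := 𝔼) (0:ℝ)).weaken zero_le

theorem wfun_zero (F : Set 𝔼) (a : 𝔼) {d : ℝ} (hd : 0 < d) (y : 𝔼) (hy : y ∉ cthickening d F) :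
    wfun F a d y = 0 := by
  unfold wfun
  split_ifs with hF
  · have : d < infDist y F := by
      rw [mem_cthickening_iff, not_le] at hy
      rw [infDist]
      exact (ENNReal.ofReal_lt_iff_lt_toReal hd.le (infEDist_ne_top hF)).1 hy
    rw [max_eq_right (by linarith), mul_zero, min_eq_right]
    exact mul_nonneg (by positivity) (saw_nonneg _)
  · rfl

theorem wfun_eq (F : Set 𝔼) (a : 𝔼) {d : ℝ} (hd : 0 < d) (y : 𝔼) (hy : y ∈ F) :
    wfun F a d y = hfun a d y := by
  unfold wfun
  rw [if_pos ⟨y, hy⟩, infDist_zero_of_mem hy, sub_zero, max_eq_left hd.le, min_eq_left]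
  unfold hfun
  have := saw_le (inner ℝ a y / d ^ 2)
  nlinarith [sq_nonneg d]

theorem lip_sum {ι : Type*} (s : Finset ι) (C : ι → ℝ≥0) (f : ι → 𝔼 → ℝ)
    (h : ∀ i, LipschitzWith (C i) (f i)) :
    LipschitzWith (∑ i ∈ s, C i) (fun x => ∑ i ∈ s, f i x) := by
  classical
  induction s using Finset.induction_on with
  | empty => simp
  | insert i s hi ih =>
    simp only [Finset.sum_insert hi]
    exact (h i).add ih

theorem measurable_gradient (u : 𝔼 → ℝ) : Measurable (gradient u) :=
  (InnerProductSpace.toDual ℝ 𝔼).symm.continuous.measurable.comp (measurable_fderiv ℝ u)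

theorem norm_gradient (u : 𝔼 → ℝ) (x : 𝔼) : ‖gradient u x‖ = ‖fderiv ℝ u x‖ := by
  simp [gradient]

/-- the test hypothesis -/
def TestH (p q N : ℝ) (φ : EuclideanSpace ℝ (Fin n) → EuclideanSpace ℝ (Fin n))
    (Ω Ω' V : Set (EuclideanSpace ℝ (Fin n))) : Prop :=
  ∀ u : EuclideanSpace ℝ (Fin n) → ℝ, LocLipschitzOn u Ω' → (∀ y ∈ Ω' \ V, u y = 0) →
    IntegrableOn (fun x => ‖gradient u x‖ ^ p) Ω' volume →
    ∃ v, HasWeakGradOn (u ∘ φ) v Ω ∧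
      ∫⁻ x in Ω, ‖v x‖ₑ ^ q ≤
        ENNReal.ofReal N ^ q * (∫⁻ x in Ω', ‖gradient u x‖ₑ ^ p) ^ (q / p)

/-- properties of the test function -/
theorem exists_test {ι : Type*} [Fintype ι] (F : ι → Set 𝔼) (a : ι → 𝔼) {d p : ℝ} (hd : 0 < d)
    (hp : 0 < p) (hF : ∀ i, IsCompact (F i)) (Ω' V : Set 𝔼)
    (hV : ∀ i, cthickening d (F i) ⊆ V)
    (hdis : ∀ i j, i ≠ j → Disjoint (cthickening d (F i)) (cthickening d (F j))) :
    ∃ u : 𝔼 → ℝ, LocLipschitzOn u Ω' ∧ (∀ y ∈ Ω' \ V, u y = 0) ∧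
      IntegrableOn (fun x => ‖gradient u x‖ ^ p) Ω' volume ∧
      (∫⁻ x in Ω', ‖gradient u x‖ₑ ^ p ≤
        ∑ i, ENNReal.ofReal (‖a i‖ + d) ^ p * volume (cthickening d (F i))) ∧
      ∀ i, ∀ y ∈ F i, u y = hfun (a i) d y := by
  classical
  set u : 𝔼 → ℝ := fun y => ∑ i, wfun (F i) (a i) d y
  have hlip : LipschitzWith (∑ i, (‖a i‖₊ + d.toNNReal)) u :=
    lip_sum _ _ _ fun i => wfun_lip (F i) (a i) hd
  have hpt : ∀ y, ‖gradient u y‖ₑ ^ p ≤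
      ∑ i, (cthickening d (F i)).indicator (fun _ => ENNReal.ofReal (‖a i‖ + d) ^ p) y := by
    intro y
    by_cases hy : ∃ i, y ∈ cthickening d (F i)
    · obtain ⟨i, hi⟩ := hy
      have ho : IsOpen (⋂ j : {j // j ≠ i}, (cthickening d (F j.1))ᶜ) :=
        isOpen_iInter_of_finite fun j => isClosed_cthickening.isOpen_compl
      have hev : u =ᶠ[𝓝 y] wfun (F i) (a i) d := by
        filter_upwards [ho.mem_nhds (mem_iInter.2 fun j => Set.disjoint_left.1 (hdis i j.1 j.2.symm) hi)]
          with z hz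
        apply Finset.sum_eq_single i
        · intro j _ hj
          exact wfun_zero _ _ hd _ (mem_iInter.1 hz ⟨j, hj⟩)
        · simp
      have h1 : ‖gradient u y‖ ≤ ‖a i‖ + d := by
        rw [norm_gradient, hev.fderiv_eq]
        refine (norm_fderiv_le_of_lipschitz ℝ (wfun_lip (F i) (a i) hd)).trans ?_
        simp [hd.le]
      refine le_trans ?_ (Finset.single_le_sum (f := fun i => (cthickening d (F i)).indicator
        (fun _ => ENNReal.ofReal (‖a i‖ + d) ^ p) y) (fun j _ => zero_le) (Finset.mem_univ i))
      simp only [indicator_of_mem hi]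
      gcongr
      rw [← ofReal_norm]
      gcongr
    · push Not at hy
      have ho : IsOpen (⋂ j, (cthickening d (F j))ᶜ) :=
        isOpen_iInter_of_finite fun j => isClosed_cthickening.isOpen_compl
      have hev : u =ᶠ[𝓝 y] fun _ => 0 := by
        filter_upwards [ho.mem_nhds (mem_iInter.2 fun j => hy j)] with z hz
        exact Finset.sum_eq_zero fun j _ => wfun_zero _ _ hd _ (mem_iInter.1 hz j)
      have : gradient u y = 0 := by
        rw [← norm_eq_zero, norm_gradient, hev.fderiv_eq]; simp
      simp [this, hp]
  have hint : ∫⁻ x in Ω', ‖gradient u x‖ₑ ^ p ≤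
        ∑ i, ENNReal.ofReal (‖a i‖ + d) ^ p * volume (cthickening d (F i)) := by
    calc ∫⁻ x in Ω', ‖gradient u x‖ₑ ^ p ≤ ∫⁻ x, ‖gradient u x‖ₑ ^ p := setLIntegral_le_lintegral _ _
      _ ≤ ∫⁻ x, ∑ i, (cthickening d (F i)).indicator (fun _ => ENNReal.ofReal (‖a i‖ + d) ^ p) x :=
        lintegral_mono hpt
      _ = _ := by
        rw [lintegral_finsetSum]
        · congr 1; ext1 i
          rw [lintegral_indicator isClosed_cthickening.measurableSet, setLIntegral_const]
        · intro i _
          exact measurable_const.indicator isClosed_cthickening.measurableSet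
  refine ⟨u, fun K _ _ => ⟨_, hlip.lipschitzOnWith⟩, ?_, ?_, hint, ?_⟩
  · rintro y ⟨_, hy⟩
    exact Finset.sum_eq_zero fun j _ => wfun_zero _ _ hd _ fun h => hy (hV j h)
  · refine ⟨((measurable_gradient u).norm.pow_const p).aestronglyMeasurable, ?_⟩
    rw [hasFiniteIntegral_iff_enorm]
    have : ∀ x, ‖‖gradient u x‖ ^ p‖ₑ = ‖gradient u x‖ₑ ^ p := by
      intro x
      rw [Real.enorm_rpow_of_nonneg (norm_nonneg _) hp.le, enorm_norm]
    simp only [this]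
    refine hint.trans_lt ?_
    rw [ENNReal.sum_lt_top]
    intro i _
    refine ENNReal.mul_lt_top (ENNReal.rpow_lt_top_of_nonneg hp.le ENNReal.ofReal_ne_top) ?_
    exact ((hF i).isBounded.cthickening).measure_lt_top
  · intro i y hy
    rw [← wfun_eq (F i) (a i) hd y hy]
    apply Finset.sum_eq_single i
    · intro j _ hj
      exact wfun_zero _ _ hd _ (Set.disjoint_left.1 (hdis i j hj.symm) (self_subset_cthickening _ hy))
    · simp

end PartSix

section PartSeven
variable {n : ℕ}
local notation "𝔼" => EuclideanSpace ℝ (Fin n)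
variable {φ : EuclideanSpace ℝ (Fin n) → EuclideanSpace ℝ (Fin n)}
  {D : EuclideanSpace ℝ (Fin n) → EuclideanSpace ℝ (Fin n) →L[ℝ] EuclideanSpace ℝ (Fin n)}
  {Ω : Set (EuclideanSpace ℝ (Fin n))} {S : ℕ → Set (EuclideanSpace ℝ (Fin n))}

theorem LocLipschitzOn.continuousOn {u : 𝔼 → ℝ} {Ω' : Set 𝔼} (hΩ' : IsOpen Ω')
    (hu : LocLipschitzOn u Ω') : ContinuousOn u Ω' := by
  intro x hx
  obtain ⟨ε, hε, h⟩ := Metric.nhds_basis_closedBall.mem_iff.1 (hΩ'.mem_nhds hx)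
  obtain ⟨C, hC⟩ := hu _ h (isCompact_closedBall x ε)
  exact (hC.continuousOn.continuousAt (closedBall_mem_nhds x hε)).continuousWithinAt

theorem measurableSet_eq_of_continuousOn {f : 𝔼 → ℝ} {B : Set 𝔼} (hB : MeasurableSet B)
    (hf : ContinuousOn f B) (c : ℝ) : MeasurableSet {x | x ∈ B ∧ f x = c} := by
  obtain ⟨t, ht, h⟩ := continuousOn_iff_isClosed.1 hf {c} isClosed_singleton
  have : {x | x ∈ B ∧ f x = c} = t ∩ B := by
    rw [← h]; ext x; simp [and_comm]
  rw [this]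
  exact ht.measurableSet.inter hB

theorem toDual_comp (a : 𝔼) (A : 𝔼 →L[ℝ] 𝔼) :
    (InnerProductSpace.toDual ℝ 𝔼 a) ∘L A =
      InnerProductSpace.toDual ℝ 𝔼 (ContinuousLinearMap.adjoint A a) := by
  ext y
  simp [ContinuousLinearMap.adjoint_inner_left]

theorem GoodD.ae_norm_eq (hg : GoodD φ D Ω S) (hn : 0 < n) (hΩ : IsOpen Ω)
    (hcont : ContinuousOn φ Ω) (f : 𝔼 → ℝ) (v : 𝔼 → 𝔼) (hf : ContinuousOn f Ω)
    (hw : HasWeakGradOn f v Ω) (a : 𝔼) {d : ℝ} (hd : 0 < d) (E : Set 𝔼) (hE : MeasurableSet E)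
    (hES : E ⊆ ⋃ m, S m) (hfE : ∀ x ∈ E, f x = hfun a d (φ x)) :
    ∀ᵐ x, x ∈ E → ‖v x‖ = ‖ContinuousLinearMap.adjoint (D x) a‖ := by
  have hA := adiff_of_weakGrad f v Ω hΩ hf hw
  have key : ∀ m : ℕ, ∀ k : ℤ, ∀ s : ℝ, |s| = 1 → ∀ᵐ x,
      x ∈ {x | x ∈ E ∩ S m ∧ f x - s * (inner ℝ a (φ x) - d ^ 2 * k) = 0} →
        ‖v x‖ = ‖ContinuousLinearMap.adjoint (D x) a‖ := by
    intro m k s hs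
    have hB : MeasurableSet (E ∩ S m) := hE.inter (hg.meas m)
    have hBΩ : E ∩ S m ⊆ Ω := inter_subset_right.trans (hg.sub m)
    have hTm := measurableSet_eq_of_continuousOn
      (f := fun x => f x - s * (inner ℝ a (φ x) - d ^ 2 * k)) hB (by
        have := hf.mono hBΩ
        have := hcont.mono hBΩ
        fun_prop) 0
    have := hA.unique hn _ hTm (fun x => s • (InnerProductSpace.toDual ℝ 𝔼 a) ∘L D x)
      (fun x => s * (inner ℝ a (φ x) - d ^ 2 * k)) (fun x hx => sub_eq_zero.1 hx.2) (by
        rintro x ⟨hx, _⟩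
        have h1 := (hg.deriv m x hx.2).mono (s := {x | x ∈ E ∩ S m ∧
          f x - s * (inner ℝ a (φ x) - d ^ 2 * k) = 0}) (fun y hy => hy.1.2)
        have h2 := ((InnerProductSpace.toDual ℝ 𝔼 a).hasFDerivAt.comp_hasFDerivWithinAt x h1)
        have h3 := (h2.sub_const (d ^ 2 * (k:ℝ))).const_mul s
        exact h3)
    filter_upwards [this] with x hx hxT
    have hx := hx ⟨hxT, hBΩ hxT.1⟩
    have := congrArg norm hx
    rw [norm_smul, toDual_comp, Real.norm_eq_abs, hs, one_mul, LinearIsometryEquiv.norm_map,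
      LinearIsometryEquiv.norm_map] at this
    exact this
  have k1 := ae_all_iff.2 fun m => ae_all_iff.2 fun k => key m k 1 (by simp)
  have k2 := ae_all_iff.2 fun m => ae_all_iff.2 fun k => key m k (-1) (by simp)
  filter_upwards [k1, k2] with x h1 h2 hxE
  obtain ⟨m, hm⟩ := mem_iUnion.1 (hES hxE)
  have hfx := hfE x hxE
  set t := inner ℝ a (φ x) / d ^ 2 with ht
  have ht' : inner ℝ a (φ x) = d ^ 2 * t := by rw [ht]; field_simp
  have hfx' : f x = d ^ 2 * |t - round t| := hfx
  rcases le_total 0 (t - round t) with h0 | h0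
  · refine h1 m (round t) ⟨⟨hxE, hm⟩, ?_⟩
    rw [hfx', abs_of_nonneg h0, ht']; ring
  · refine h2 m (round t) ⟨⟨hxE, hm⟩, ?_⟩
    rw [hfx', abs_of_nonpos h0, ht']; ring

theorem GoodD.test_ineq (hg : GoodD φ D Ω S) (hn : 0 < n) (hΩ : IsOpen Ω)
    (hcont : ContinuousOn φ Ω) (hinj : InjOn φ Ω) {Ω' U : Set 𝔼} (hΩ' : IsOpen Ω')
    (hmap : MapsTo φ Ω Ω') (hUΩ : U ⊆ Ω) (hV : IsOpen (φ '' U)) {p q N : ℝ} (hp : 0 < p) (hq : 0 < q)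
    (hT : TestH p q N φ Ω Ω' (φ '' U)) {ι : Type*} [Fintype ι] (E : ι → Set 𝔼) (a : ι → 𝔼)
    (hEc : ∀ i, IsCompact (E i)) (hES : ∀ i, E i ⊆ ⋃ m, S m) (hEU : ∀ i, E i ⊆ U)
    (hEd : ∀ i j, i ≠ j → Disjoint (E i) (E j)) :
    ∑ i, ∫⁻ x in E i, ‖ContinuousLinearMap.adjoint (D x) (a i)‖ₑ ^ q ≤
      ENNReal.ofReal N ^ q * (∑ i, ‖a i‖ₑ ^ p * volume (φ '' E i)) ^ (q / p) := by
  have hFc : ∀ i, IsCompact (φ '' E i) := fun i =>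
    (hEc i).image_of_continuousOn (hcont.mono ((hEU i).trans hUΩ))
  have hFd : ∀ i j, i ≠ j → Disjoint (φ '' E i) (φ '' E j) := by
    intro i j hij
    exact disjoint_image_image fun x hx y hy hxy => by
      have := hinj (hUΩ (hEU _ hx)) (hUΩ (hEU _ hy)) hxy
      subst this
      exact Set.disjoint_left.1 (hEd i j hij) hx hy
  have ev1 : ∀ i, ∀ᶠ d : ℝ in 𝓝[>] 0, cthickening d (φ '' E i) ⊆ φ '' U := by
    intro i
    obtain ⟨δ, hδ, h⟩ := (hFc i).exists_cthickening_subset_open hV (image_mono (hEU i))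
    filter_upwards [Ioo_mem_nhdsGT hδ] with d hd
    exact (cthickening_mono hd.2.le _).trans h
  have ev2 : ∀ i j, ∀ᶠ d : ℝ in 𝓝[>] 0, i ≠ j →
      Disjoint (cthickening d (φ '' E i)) (cthickening d (φ '' E j)) := by
    intro i j
    by_cases hij : i = j
    · exact Eventually.of_forall fun d h => absurd hij h
    obtain ⟨δ, hδ, h⟩ := (hFd i j hij).exists_cthickenings (hFc i) (hFc j).isClosed
    filter_upwards [Ioo_mem_nhdsGT hδ] with d hd _
    exact h.mono (cthickening_mono hd.2.le _) (cthickening_mono hd.2.le _)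
  have key : ∀ᶠ d : ℝ in 𝓝[>] 0,
      ∑ i, ∫⁻ x in E i, ‖ContinuousLinearMap.adjoint (D x) (a i)‖ₑ ^ q ≤
      ENNReal.ofReal N ^ q *
        (∑ i, ENNReal.ofReal (‖a i‖ + d) ^ p * volume (cthickening d (φ '' E i))) ^ (q / p) := by
    filter_upwards [eventually_all.2 ev1, eventually_all.2 fun i => eventually_all.2 (ev2 i),
      self_mem_nhdsWithin] with d h1 h2 (hd : 0 < d)
    obtain ⟨u, hu1, hu2, hu3, hu4, hu5⟩ := exists_test (fun i => φ '' E i) a hd hp hFc Ω' (φ '' U) h1 h2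
    obtain ⟨v, hv, hvb⟩ := hT u hu1 hu2 hu3
    have hfc : ContinuousOn (u ∘ φ) Ω := (hu1.continuousOn hΩ').comp hcont hmap
    have hE : ∀ i, ∫⁻ x in E i, ‖ContinuousLinearMap.adjoint (D x) (a i)‖ₑ ^ q
        = ∫⁻ x in E i, ‖v x‖ₑ ^ q := by
      intro i
      have := hg.ae_norm_eq hn hΩ hcont (u ∘ φ) v hfc hv (a i) hd (E i) (hEc i).measurableSet (hES i)
        (fun x hx => hu5 i _ (mem_image_of_mem φ hx))
      apply setLIntegral_congr_fun_ae (hEc i).measurableSet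
      filter_upwards [this] with x hx hxE
      rw [← ofReal_norm, ← ofReal_norm, hx hxE]
    calc ∑ i, ∫⁻ x in E i, ‖ContinuousLinearMap.adjoint (D x) (a i)‖ₑ ^ q
        = ∑ i, ∫⁻ x in E i, ‖v x‖ₑ ^ q := Finset.sum_congr rfl fun i _ => hE i
      _ = ∫⁻ x in ⋃ i ∈ (Finset.univ : Finset ι), E i, ‖v x‖ₑ ^ q := by
        rw [lintegral_biUnion_finset]
        · intro i _ j _ hij; exact hEd i j hij
        · exact fun i _ => (hEc i).measurableSet
      _ ≤ ∫⁻ x in Ω, ‖v x‖ₑ ^ q :=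
        lintegral_mono_set (iUnion₂_subset fun i _ => (hEU i).trans hUΩ)
      _ ≤ _ := hvb.trans (by gcongr)
  refine ge_of_tendsto ?_ key
  refine ENNReal.Tendsto.const_mul ?_ (Or.inr (ENNReal.rpow_ne_top_of_nonneg hq.le ENNReal.ofReal_ne_top))
  refine (ENNReal.continuous_rpow_const.tendsto _).comp ?_
  refine tendsto_finsetSum _ fun i _ => ?_
  refine ENNReal.Tendsto.mul ?_ (Or.inr (hFc i).measure_lt_top.ne) ?_
    (Or.inr (ENNReal.rpow_ne_top_of_nonneg hp.le enorm_ne_top))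
  · refine (ENNReal.continuous_rpow_const.tendsto _).comp ?_
    rw [← ofReal_norm]
    refine (ENNReal.continuous_ofReal.tendsto _).comp ?_
    have : Tendsto (fun d : ℝ => ‖a i‖ + d) (𝓝[>] 0) (𝓝 (‖a i‖ + 0)) :=
      tendsto_const_nhds.add (tendsto_nhdsWithin_of_tendsto_nhds tendsto_id)
    simpa using this
  · exact tendsto_nhdsWithin_of_tendsto_nhds (tendsto_measure_cthickening_of_isCompact (hFc i))

end PartSeven

section PartEight
variable {n : ℕ}
local notation "𝔼" => EuclideanSpace ℝ (Fin n)
variable {φ : EuclideanSpace ℝ (Fin n) → EuclideanSpace ℝ (Fin n)}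
  {D : EuclideanSpace ℝ (Fin n) → EuclideanSpace ℝ (Fin n) →L[ℝ] EuclideanSpace ℝ (Fin n)}
  {Ω : Set (EuclideanSpace ℝ (Fin n))} {S : ℕ → Set (EuclideanSpace ℝ (Fin n))}

theorem exists_compact_exhaust (B : Set 𝔼) (hB : MeasurableSet B) :
    ∃ K : ℕ → Set 𝔼, (∀ k, IsCompact (K k)) ∧ Monotone K ∧ (∀ k, K k ⊆ B) ∧
      (⋃ k, K k : Set 𝔼) =ᵐ[volume] B := by
  have h1 : ∀ j : ℕ, ∃ K ⊆ B ∩ closedBall 0 j, IsCompact K ∧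
      volume ((B ∩ closedBall 0 j) \ K) < ENNReal.ofReal (1 / ((j:ℝ) + 1)) := by
    intro j
    refine MeasurableSet.exists_isCompact_sdiff_lt (hB.inter measurableSet_closedBall) ?_ ?_
    · exact (measure_mono inter_subset_right |>.trans_lt measure_closedBall_lt_top).ne
    · have : 0 < 1 / ((j:ℝ) + 1) := by positivity
      simpa using this
  choose K hKs hKc hKv using h1
  refine ⟨accumulate K, ?_, monotone_accumulate, ?_, ?_⟩
  · intro k
    exact (Set.finite_Iic k).isCompact_biUnion fun i _ => hKc i
  · intro k
    exact iUnion₂_subset fun i _ => (hKs i).trans inter_subset_left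
  · rw [iUnion_accumulate]
    have hs : (⋃ k, K k) ⊆ B := iUnion_subset fun i => (hKs i).trans inter_subset_left
    have hz : volume (B \ ⋃ k, K k) = 0 := by
      have : B \ ⋃ k, K k ⊆ ⋃ j : ℕ, (B ∩ closedBall 0 j) \ ⋃ k, K k := by
        rintro x ⟨hx, hx2⟩
        obtain ⟨j, hj⟩ := exists_nat_ge ‖x‖
        exact mem_iUnion.2 ⟨j, ⟨hx, by simpa using hj⟩, hx2⟩
      refine measure_mono_null this (measure_iUnion_null fun j => ?_)
      have hlim : Tendsto (fun i : ℕ => ENNReal.ofReal (1 / ((i:ℝ) + 1))) atTop (𝓝 0) := by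
        have := (ENNReal.continuous_ofReal.tendsto _).comp
          (tendsto_one_div_add_atTop_nhds_zero_nat (𝕜 := ℝ))
        simpa [Function.comp_def] using this
      refine le_antisymm (ge_of_tendsto hlim ?_) zero_le
      filter_upwards [eventually_ge_atTop j] with i hi
      refine (measure_mono ?_).trans (hKv i).le
      rintro x ⟨⟨h1, h2⟩, h3⟩
      refine ⟨⟨h1, closedBall_subset_closedBall (by exact_mod_cast hi) h2⟩, fun h => h3 (mem_iUnion.2 ⟨i, h⟩)⟩
    filter_upwards [measure_eq_zero_iff_ae_notMem.1 hz] with x hx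
    apply propext
    refine ⟨fun h => hs h, fun h => ?_⟩
    by_contra h'
    exact hx ⟨h, h'⟩

theorem measurable_adj (hD : Measurable D) {a : 𝔼 → 𝔼} (ha : Measurable a) :
    Measurable fun x => ContinuousLinearMap.adjoint (D x) (a x) := by
  have h1 : Measurable fun x => ContinuousLinearMap.adjoint (D x) :=
    (ContinuousLinearMap.adjoint (𝕜 := ℝ) (E := 𝔼) (F := 𝔼)).continuous.measurable.comp hD
  exact ContinuousLinearMap.measurable_apply₂.comp (h1.prodMk ha)

theorem measurable_det (hD : Measurable D) : Measurable fun x => (D x).det :=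
  ContinuousLinearMap.continuous_det.measurable.comp hD

theorem GoodD.simple_ineq (hg : GoodD φ D Ω S) (hn : 0 < n) (hΩ : IsOpen Ω)
    (hcont : ContinuousOn φ Ω) (hinj : InjOn φ Ω) {Ω' U : Set 𝔼} (hΩ' : IsOpen Ω')
    (hmap : MapsTo φ Ω Ω') (hUo : IsOpen U) (hUΩ : U ⊆ Ω) (hV : IsOpen (φ '' U)) {p q N : ℝ}
    (hp : 0 < p) (hq : 0 < q)
    (hT : TestH p q N φ Ω Ω' (φ '' U)) (f : SimpleFunc 𝔼 𝔼) :
    ∫⁻ x in U, ‖ContinuousLinearMap.adjoint (D x) (f x)‖ₑ ^ q ≤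
      ENNReal.ofReal N ^ q *
        (∫⁻ x in U, ‖f x‖ₑ ^ p * ENNReal.ofReal |(D x).det|) ^ (q / p) := by
  let B : f.range → Set 𝔼 := fun c => (f ⁻¹' {c.1}) ∩ (U ∩ ⋃ m, S m)
  have hBm : ∀ c, MeasurableSet (B c) := fun c =>
    (f.measurableSet_fiber _).inter (hUo.measurableSet.inter (MeasurableSet.iUnion hg.meas))
  have hBd : ∀ c c', c ≠ c' → Disjoint (B c) (B c') := by
    intro c c' hcc
    rw [Set.disjoint_left]
    rintro x ⟨h1, _⟩ ⟨h2, _⟩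
    apply hcc
    ext1
    rw [← show f x = c.1 from h1, ← show f x = c'.1 from h2]
  have hBU : (⋃ c ∈ (Finset.univ : Finset f.range), B c : Set 𝔼) =ᵐ[volume] U := by
    filter_upwards [hg.ae_mem] with x hx
    apply propext
    constructor
    · intro h
      obtain ⟨c, _, hc⟩ := mem_iUnion₂.1 h
      exact hc.2.1
    · intro h
      exact mem_iUnion₂.2 ⟨⟨f x, f.mem_range_self x⟩, Finset.mem_univ _, rfl, h, hx (hUΩ h)⟩
  have hsplit : ∀ g : 𝔼 → ℝ≥0∞, ∫⁻ x in U, g x = ∑ c, ∫⁻ x in B c, g x := by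
    intro g
    rw [← setLIntegral_congr hBU, lintegral_biUnion_finset]
    · intro i _ j _ hij; exact hBd i j hij
    · exact fun i _ => hBm i
  have hK := fun c => exists_compact_exhaust (B c) (hBm c)
  choose K hKc hKm hKB hKe using hK
  have hmain : ∀ k, ∑ c, ∫⁻ x in K c k, ‖ContinuousLinearMap.adjoint (D x) c.1‖ₑ ^ q ≤
      ENNReal.ofReal N ^ q *
        (∫⁻ x in U, ‖f x‖ₑ ^ p * ENNReal.ofReal |(D x).det|) ^ (q / p) := by
    intro k
    refine (hg.test_ineq hn hΩ hcont hinj hΩ' hmap hUΩ hV hp hq hT (fun c => K c k) (fun c => c.1)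
      (fun c => hKc c k) (fun c => (hKB c k).trans (inter_subset_right.trans inter_subset_right))
      (fun c => (hKB c k).trans (inter_subset_right.trans inter_subset_left))
      (fun c c' h => (hBd c c' h).mono (hKB c k) (hKB c' k))).trans ?_
    rw [hsplit]
    gcongr with c _
    rw [hg.volume_image hinj _ (hKc c k).measurableSet
      ((hKB c k).trans (inter_subset_right.trans inter_subset_right)), ← lintegral_const_mul' _ _
      (ENNReal.rpow_ne_top_of_nonneg hp.le enorm_ne_top)]
    refine (lintegral_mono_set (hKB c k)).trans (le_of_eq ?_)
    apply setLIntegral_congr_fun (hBm c)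
    rintro x ⟨hx, _⟩
    rw [← show f x = c.1 from hx]
  rw [hsplit]
  have hlim : Tendsto (fun k => ∑ c, ∫⁻ x in K c k, ‖ContinuousLinearMap.adjoint (D x) c.1‖ₑ ^ q) atTop
      (𝓝 (∑ c, ∫⁻ x in B c, ‖ContinuousLinearMap.adjoint (D x) (f x)‖ₑ ^ q)) := by
    refine tendsto_finsetSum _ fun c _ => ?_
    have e : ∫⁻ x in B c, ‖ContinuousLinearMap.adjoint (D x) (f x)‖ₑ ^ q
        = ⨆ k, ∫⁻ x in K c k, ‖ContinuousLinearMap.adjoint (D x) c.1‖ₑ ^ q := by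
      rw [← setLIntegral_iUnion_of_directed _ (hKm c).directed_le, setLIntegral_congr (hKe c)]
      apply setLIntegral_congr_fun (hBm c)
      rintro x ⟨hx, _⟩
      rw [← show f x = c.1 from hx]
    rw [e]
    exact tendsto_atTop_iSup fun i j hij => lintegral_mono_set (hKm c hij)
  exact le_of_tendsto' hlim hmain

theorem GoodD.star_ineq (hg : GoodD φ D Ω S) (hn : 0 < n) (hΩ : IsOpen Ω)
    (hcont : ContinuousOn φ Ω) (hinj : InjOn φ Ω) {Ω' U : Set 𝔼} (hΩ' : IsOpen Ω')
    (hmap : MapsTo φ Ω Ω') (hUo : IsOpen U) (hUΩ : U ⊆ Ω) (hV : IsOpen (φ '' U)) {p q N : ℝ}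
    (hp : 0 < p) (hq : 0 < q)
    (hT : TestH p q N φ Ω Ω' (φ '' U)) (a : 𝔼 → 𝔼) (ha : Measurable a)
    (hfin : ∫⁻ x in U, ‖a x‖ₑ ^ p * ENNReal.ofReal |(D x).det| ≠ ∞) :
    ∫⁻ x in U, ‖ContinuousLinearMap.adjoint (D x) (a x)‖ₑ ^ q ≤
      ENNReal.ofReal N ^ q *
        (∫⁻ x in U, ‖a x‖ₑ ^ p * ENNReal.ofReal |(D x).det|) ^ (q / p) := by
  let f : ℕ → SimpleFunc 𝔼 𝔼 := fun k => SimpleFunc.approxOn a ha univ 0 (mem_univ _) k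
  have hft : ∀ x, Tendsto (fun k => f k x) atTop (𝓝 (a x)) := fun x =>
    SimpleFunc.tendsto_approxOn ha (mem_univ _) (by simp)
  have hfb : ∀ k x, ‖f k x‖ₑ ≤ 2 * ‖a x‖ₑ := by
    intro k x
    have := SimpleFunc.norm_approxOn_zero_le ha (mem_univ (0:𝔼)) x k
    rw [two_mul, ← ofReal_norm, ← ofReal_norm, ← ENNReal.ofReal_add (norm_nonneg _) (norm_nonneg _)]
    exact ENNReal.ofReal_le_ofReal this
  have hJm : Measurable fun x => ENNReal.ofReal |(D x).det| := by
    have := measurable_det hg.measD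
    fun_prop
  have hR : Tendsto (fun k => ∫⁻ x in U, ‖f k x‖ₑ ^ p * ENNReal.ofReal |(D x).det|) atTop
      (𝓝 (∫⁻ x in U, ‖a x‖ₑ ^ p * ENNReal.ofReal |(D x).det|)) := by
    apply tendsto_lintegral_of_dominated_convergence
      (fun x => 2 ^ p * (‖a x‖ₑ ^ p * ENNReal.ofReal |(D x).det|))
    · intro k
      exact ((f k).measurable.enorm.pow_const p).mul hJm
    · intro k
      filter_upwards with x
      rw [← mul_assoc, ← ENNReal.mul_rpow_of_nonneg _ _ hp.le]
      gcongr
      exact hfb k x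
    · rw [lintegral_const_mul' _ _ (ENNReal.rpow_ne_top_of_nonneg hp.le (by simp))]
      exact ENNReal.mul_ne_top (ENNReal.rpow_ne_top_of_nonneg hp.le (by simp)) hfin
    · filter_upwards with x
      refine ENNReal.Tendsto.mul_const ?_ (Or.inr ENNReal.ofReal_ne_top)
      exact (ENNReal.continuous_rpow_const.tendsto _).comp ((hft x).enorm)
  have hR2 : Tendsto (fun k => ENNReal.ofReal N ^ q *
        (∫⁻ x in U, ‖f k x‖ₑ ^ p * ENNReal.ofReal |(D x).det|) ^ (q / p)) atTop
      (𝓝 (ENNReal.ofReal N ^ q *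
        (∫⁻ x in U, ‖a x‖ₑ ^ p * ENNReal.ofReal |(D x).det|) ^ (q / p))) := by
    refine ENNReal.Tendsto.const_mul ?_
      (Or.inr (ENNReal.rpow_ne_top_of_nonneg hq.le ENNReal.ofReal_ne_top))
    exact (ENNReal.continuous_rpow_const.tendsto _).comp hR
  have hle := fun k => hg.simple_ineq hn hΩ hcont hinj hΩ' hmap hUo hUΩ hV hp hq hT (f k)
  calc ∫⁻ x in U, ‖ContinuousLinearMap.adjoint (D x) (a x)‖ₑ ^ q
      = ∫⁻ x in U, liminf (fun k => ‖ContinuousLinearMap.adjoint (D x) (f k x)‖ₑ ^ q) atTop := by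
        congr 1; ext1 x
        refine (Tendsto.liminf_eq ?_).symm
        refine (ENNReal.continuous_rpow_const.tendsto _).comp (Tendsto.enorm ?_)
        exact ((ContinuousLinearMap.adjoint (D x)).continuous.tendsto _).comp (hft x)
    _ ≤ liminf (fun k => ∫⁻ x in U, ‖ContinuousLinearMap.adjoint (D x) (f k x)‖ₑ ^ q) atTop := by
        apply lintegral_liminf_le
        intro k
        exact (measurable_adj hg.measD (f k).measurable).enorm.pow_const q
    _ ≤ liminf (fun k => ENNReal.ofReal N ^ q *
        (∫⁻ x in U, ‖f k x‖ₑ ^ p * ENNReal.ofReal |(D x).det|) ^ (q / p)) atTop :=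
        liminf_le_liminf (Eventually.of_forall hle)
    _ = _ := hR2.liminf_eq

end PartEight

section PartNine
variable {n : ℕ}
local notation "𝔼" => EuclideanSpace ℝ (Fin n)
variable {φ : EuclideanSpace ℝ (Fin n) → EuclideanSpace ℝ (Fin n)}
  {D : EuclideanSpace ℝ (Fin n) → EuclideanSpace ℝ (Fin n) →L[ℝ] EuclideanSpace ℝ (Fin n)}
  {Ω : Set (EuclideanSpace ℝ (Fin n))} {S : ℕ → Set (EuclideanSpace ℝ (Fin n))}

theorem exists_dir (hD : Measurable D) {θ : ℝ} (hθ1 : θ < 1) :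
    ∃ e : 𝔼 → 𝔼, Measurable e ∧ (∀ x, ‖e x‖ ≤ 1) ∧
      ∀ x, θ * ‖D x‖ ≤ ‖ContinuousLinearMap.adjoint (D x) (e x)‖ := by
  classical
  have : Nonempty (closedBall (0:𝔼) 1) := ⟨⟨0, by simp⟩⟩
  let w : ℕ → 𝔼 := fun k => (TopologicalSpace.denseSeq (closedBall (0:𝔼) 1) k : 𝔼)
  have hex : ∀ x, ∃ k, θ * ‖D x‖ ≤ ‖ContinuousLinearMap.adjoint (D x) (w k)‖ := by
    intro x
    by_cases h0 : ‖D x‖ = 0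
    · exact ⟨0, by rw [h0, mul_zero]; exact norm_nonneg _⟩
    have hpos : 0 < ‖D x‖ := lt_of_le_of_ne (norm_nonneg _) (Ne.symm h0)
    have hlt : θ * ‖D x‖ < ‖ContinuousLinearMap.adjoint (D x)‖ := by
      rw [LinearIsometryEquiv.norm_map]; nlinarith
    obtain ⟨z, hz, hz2⟩ := (ContinuousLinearMap.adjoint (D x)).exists_lt_apply_of_lt_opNorm hlt
    have ho : IsOpen {y : closedBall (0:𝔼) 1 | θ * ‖D x‖ < ‖ContinuousLinearMap.adjoint (D x) y.1‖} :=
      isOpen_lt continuous_const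
        ((ContinuousLinearMap.adjoint (D x)).continuous.comp continuous_subtype_val).norm
    obtain ⟨y, hy, k, rfl⟩ := (TopologicalSpace.denseRange_denseSeq (closedBall (0:𝔼) 1)).inter_open_nonempty _ ho
      ⟨⟨z, by simpa using hz.le⟩, hz2⟩
    exact ⟨k, hy.le⟩
  refine ⟨fun x => w (Nat.find (hex x)), ?_, ?_, ?_⟩
  · refine (measurable_from_nat (f := w)).comp (measurable_find hex fun k => ?_)
    exact measurableSet_le (hD.norm.const_mul θ) (measurable_adj hD measurable_const).norm
  · intro x
    have := (TopologicalSpace.denseSeq (closedBall (0:𝔼) 1) (Nat.find (hex x))).2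
    exact mem_closedBall_zero_iff.1 this
  · exact fun x => Nat.find_spec (hex x)

theorem distortionFn_nonneg (p : ℝ) (x : 𝔼) : 0 ≤ distortionFn p D x := by
  unfold distortionFn
  split_ifs <;> positivity

theorem distortionFn_of_det_eq_zero (p : ℝ) (x : 𝔼) (h : (D x).det = 0) :
    distortionFn p D x = 0 := by
  unfold distortionFn
  rw [if_neg]
  rw [not_not]; exact h

theorem distortionFn_of_det_ne_zero (p : ℝ) (x : 𝔼) (h : (D x).det ≠ 0) :
    distortionFn p D x = ‖D x‖ / |(D x).det| ^ (1 / p) := by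
  unfold distortionFn
  exact if_pos h

theorem measurable_distortionFn (hD : Measurable D) (p : ℝ) : Measurable (distortionFn p D) := by
  have h1 := measurable_det hD
  have : distortionFn p D = fun x => if (D x).det ≠ 0 then ‖D x‖ / |(D x).det| ^ (1 / p) else 0 := by
    ext x
    split_ifs with h
    · exact distortionFn_of_det_ne_zero p x h
    · exact distortionFn_of_det_eq_zero p x (not_not.1 h)
  rw [this]
  refine Measurable.ite ?_ ?_ measurable_const
  · exact (h1 (measurableSet_singleton 0)).compl
  · have := hD.norm
    have h2 : Measurable fun x => |(D x).det| := by fun_prop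
    exact this.div (h2.pow_const _)

theorem GoodD.deriv_zero (hg : GoodD φ D Ω S) (hn : 0 < n) (hΩ : IsOpen Ω)
    (hcont : ContinuousOn φ Ω) (hinj : InjOn φ Ω) {Ω' U : Set 𝔼} (hΩ' : IsOpen Ω')
    (hmap : MapsTo φ Ω Ω') (hUo : IsOpen U) (hUΩ : U ⊆ Ω) (hV : IsOpen (φ '' U)) {p q N : ℝ}
    (hp : 0 < p) (hq : 0 < q)
    (hT : TestH p q N φ Ω Ω' (φ '' U)) :
    ∀ᵐ x, x ∈ U → (D x).det = 0 → D x = 0 := by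
  obtain ⟨e, hem, he1, heD⟩ := exists_dir hg.measD (show (1/2 : ℝ) < 1 by norm_num)
  have hJ : MeasurableSet {x | (D x).det = 0} := measurable_det hg.measD (measurableSet_singleton 0)
  set a : 𝔼 → 𝔼 := {x | (D x).det = 0}.indicator e
  have ha : Measurable a := hem.indicator hJ
  have hz : ∀ x, ‖a x‖ₑ ^ p * ENNReal.ofReal |(D x).det| = 0 := by
    intro x
    by_cases hx : (D x).det = 0
    · simp [hx]
    · have : a x = 0 := indicator_of_notMem (show x ∉ {x | (D x).det = 0} from hx) _
      simp [this, hp]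
  have h0 : ∫⁻ x in U, ‖a x‖ₑ ^ p * ENNReal.ofReal |(D x).det| = 0 := by simp [hz]
  have := hg.star_ineq hn hΩ hcont hinj hΩ' hmap hUo hUΩ hV hp hq hT a ha (by rw [h0]; simp)
  rw [h0, ENNReal.zero_rpow_of_pos (by positivity), mul_zero, nonpos_iff_eq_zero,
    lintegral_eq_zero_iff ((measurable_adj hg.measD ha).enorm.pow_const q), EventuallyEq,
    ae_restrict_iff' hUo.measurableSet] at this
  filter_upwards [this] with x hx hxU hxJ
  have hx := hx hxU
  have hax : a x = e x := indicator_of_mem (show x ∈ {x | (D x).det = 0} from hxJ) _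
  rw [Pi.zero_apply, ENNReal.rpow_eq_zero_iff_of_pos hq, enorm_eq_zero, hax] at hx
  have h3 := heD x
  rw [hx, norm_zero] at h3
  have h4 := norm_nonneg (D x)
  exact norm_eq_zero.1 (by linarith)

theorem GoodD.core (hg : GoodD φ D Ω S) (hn : 0 < n) (hΩ : IsOpen Ω)
    (hcont : ContinuousOn φ Ω) (hinj : InjOn φ Ω) {Ω' U : Set 𝔼} (hΩ' : IsOpen Ω')
    (hmap : MapsTo φ Ω Ω') (hUo : IsOpen U) (hUΩ : U ⊆ Ω) (hV : IsOpen (φ '' U)) {p q N : ℝ}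
    (hp : 0 < p) (hq : 0 < q)
    (hT : TestH p q N φ Ω Ω' (φ '' U)) (τ : 𝔼 → ℝ) (hτm : Measurable τ) (hτ0 : ∀ x, 0 ≤ τ x)
    (hfin : ∫⁻ x in U, ENNReal.ofReal (τ x) ≠ ∞) :
    ∫⁻ x in U, ENNReal.ofReal ((τ x ^ (1 / p) * distortionFn p D x) ^ q) ≤
      ENNReal.ofReal N ^ q * (∫⁻ x in U, ENNReal.ofReal (τ x)) ^ (q / p) := by
  have hJm := measurable_det hg.measD
  have hJm' : Measurable fun x => |(D x).det| := by fun_prop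
  have key : ∀ θ : ℝ, 0 < θ → θ < 1 → ENNReal.ofReal (θ ^ q) *
      ∫⁻ x in U, ENNReal.ofReal ((τ x ^ (1 / p) * distortionFn p D x) ^ q) ≤
      ENNReal.ofReal N ^ q * (∫⁻ x in U, ENNReal.ofReal (τ x)) ^ (q / p) := by
    intro θ hθ hθ1
    obtain ⟨e, hem, he1, heD⟩ := exists_dir hg.measD hθ1
    set ρ : 𝔼 → ℝ := fun x => (τ x / |(D x).det|) ^ (1 / p)
    have hρ0 : ∀ x, 0 ≤ ρ x := fun x => Real.rpow_nonneg (div_nonneg (hτ0 x) (abs_nonneg _)) _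
    have hρm : Measurable ρ := (hτm.div hJm').pow_const _
    have hle : ∀ x, ‖ρ x • e x‖ₑ ^ p * ENNReal.ofReal |(D x).det| ≤ ENNReal.ofReal (τ x) := by
      intro x
      rw [← ofReal_norm, ENNReal.ofReal_rpow_of_nonneg (norm_nonneg _) hp.le,
        ← ENNReal.ofReal_mul (by positivity)]
      apply ENNReal.ofReal_le_ofReal
      by_cases hx : (D x).det = 0
      · simp [hx, hτ0 x]
      have hx' : 0 < |(D x).det| := abs_pos.2 hx
      calc ‖ρ x • e x‖ ^ p * |(D x).det| ≤ ρ x ^ p * |(D x).det| := by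
            gcongr
            rw [norm_smul, Real.norm_of_nonneg (hρ0 x)]
            exact mul_le_of_le_one_right (hρ0 x) (he1 x)
        _ = τ x := by
            simp only [ρ]
            rw [← Real.rpow_mul (div_nonneg (hτ0 x) hx'.le), one_div_mul_cancel hp.ne', Real.rpow_one]
            field_simp
    have hge : ∀ x, ENNReal.ofReal (θ ^ q) * ENNReal.ofReal ((τ x ^ (1 / p) * distortionFn p D x) ^ q) ≤
        ‖ContinuousLinearMap.adjoint (D x) (ρ x • e x)‖ₑ ^ q := by
      intro x
      rw [← ofReal_norm, ENNReal.ofReal_rpow_of_nonneg (norm_nonneg _) hq.le,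
        ← ENNReal.ofReal_mul (by positivity)]
      apply ENNReal.ofReal_le_ofReal
      have hd0 := distortionFn_nonneg (D := D) p x
      have ht0 : 0 ≤ τ x ^ (1 / p) := Real.rpow_nonneg (hτ0 x) _
      rw [← Real.mul_rpow hθ.le (by positivity)]
      apply Real.rpow_le_rpow (by positivity) _ hq.le
      rw [map_smul, norm_smul, Real.norm_of_nonneg (hρ0 x)]
      by_cases hx : (D x).det = 0
      · rw [distortionFn_of_det_eq_zero p x hx]
        have := hρ0 x
        simp only [mul_zero]
        positivity
      have hx' : 0 < |(D x).det| := abs_pos.2 hx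
      calc θ * (τ x ^ (1 / p) * distortionFn p D x) = ρ x * (θ * ‖D x‖) := by
            rw [distortionFn_of_det_ne_zero p x hx]
            simp only [ρ]
            rw [Real.div_rpow (hτ0 x) hx'.le]
            ring
        _ ≤ _ := mul_le_mul_of_nonneg_left (heD x) (hρ0 x)
    have hI : ∫⁻ x in U, ‖ρ x • e x‖ₑ ^ p * ENNReal.ofReal |(D x).det| ≤
        ∫⁻ x in U, ENNReal.ofReal (τ x) := lintegral_mono hle
    have := hg.star_ineq hn hΩ hcont hinj hΩ' hmap hUo hUΩ hV hp hq hT (fun x => ρ x • e x)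
      (hρm.smul hem) (ne_top_of_le_ne_top hfin hI)
    rw [← lintegral_const_mul' _ _ ENNReal.ofReal_ne_top]
    refine (lintegral_mono hge).trans (this.trans ?_)
    gcongr
  have hlim : Tendsto (fun θ : ℝ => ENNReal.ofReal (θ ^ q) *
      ∫⁻ x in U, ENNReal.ofReal ((τ x ^ (1 / p) * distortionFn p D x) ^ q)) (𝓝[<] 1)
      (𝓝 (1 * ∫⁻ x in U, ENNReal.ofReal ((τ x ^ (1 / p) * distortionFn p D x) ^ q))) := by
    refine ENNReal.Tendsto.mul_const ?_ (Or.inl one_ne_zero)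
    rw [← ENNReal.ofReal_one]
    refine (ENNReal.continuous_ofReal.tendsto _).comp ?_
    have := (Real.continuousAt_rpow_const 1 q (Or.inl one_ne_zero)).tendsto
    rw [Real.one_rpow] at this
    exact tendsto_nhdsWithin_of_tendsto_nhds this
  rw [one_mul] at hlim
  refine le_of_tendsto hlim ?_
  filter_upwards [Ioo_mem_nhdsLT (show (0:ℝ) < 1 by norm_num)] with θ hθ
  exact key θ hθ.1 hθ.2

theorem GoodD.lower_eq (hg : GoodD φ D Ω S) (hn : 0 < n) (hΩ : IsOpen Ω)
    (hcont : ContinuousOn φ Ω) (hinj : InjOn φ Ω) {Ω' U : Set 𝔼} (hΩ' : IsOpen Ω')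
    (hmap : MapsTo φ Ω Ω') (hUo : IsOpen U) (hUΩ : U ⊆ Ω) (hV : IsOpen (φ '' U)) {p N : ℝ}
    (hp : 0 < p) (hN : 0 ≤ N)
    (hT : TestH p p N φ Ω Ω' (φ '' U)) :
    ∀ᵐ x, x ∈ U → distortionFn p D x ≤ N := by
  have hKm := measurable_distortionFn hg.measD p
  have key : ∀ c : ℝ, N < c → ∀ R : ℕ, volume ({x | c ≤ distortionFn p D x} ∩ closedBall 0 R ∩ U) = 0 := by
    intro c hc R
    set B := {x | c ≤ distortionFn p D x} ∩ closedBall (0:𝔼) R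
    have hBm : MeasurableSet B := (measurableSet_le measurable_const hKm).inter measurableSet_closedBall
    have hBf : volume (B ∩ U) ≠ ∞ :=
      ((measure_mono (inter_subset_left.trans inter_subset_right)).trans_lt measure_closedBall_lt_top).ne
    have e1 : ∀ x, ENNReal.ofReal (B.indicator (fun _ => (1:ℝ)) x) = B.indicator (fun _ => 1) x := by
      intro x
      by_cases hx : x ∈ B <;> simp [hx]
    have hW : ∫⁻ x in U, ENNReal.ofReal (B.indicator (fun _ => (1:ℝ)) x) = volume (B ∩ U) := by
      simp only [e1]
      rw [lintegral_indicator hBm, Measure.restrict_restrict hBm]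
      simp
    have := hg.core hn hΩ hcont hinj hΩ' hmap hUo hUΩ hV hp hp hT (B.indicator fun _ => 1)
      (measurable_const.indicator hBm) (fun x => indicator_nonneg (fun _ _ => zero_le_one) x)
      (by rw [hW]; exact hBf)
    rw [hW, div_self hp.ne', ENNReal.rpow_one] at this
    have h2 : ENNReal.ofReal c ^ p * volume (B ∩ U) ≤ ENNReal.ofReal N ^ p * volume (B ∩ U) := by
      refine le_trans ?_ this
      rw [← setLIntegral_const, ← Measure.restrict_restrict hBm, ← lintegral_indicator hBm]
      refine lintegral_mono fun x => ?_
      by_cases hx : x ∈ B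
      · rw [indicator_of_mem hx, indicator_of_mem hx, Real.one_rpow, one_mul,
          ENNReal.ofReal_rpow_of_nonneg (hN.trans hc.le) hp.le]
        apply ENNReal.ofReal_le_ofReal
        exact Real.rpow_le_rpow (hN.trans hc.le) hx.1 hp.le
      · rw [indicator_of_notMem hx]; exact zero_le
    by_contra hne
    have h3 := (ENNReal.mul_le_mul_iff_left hne hBf).1 h2
    rw [ENNReal.rpow_le_rpow_iff hp, ENNReal.ofReal_le_ofReal_iff hN] at h3
    linarith
  have h1 : ∀ k R : ℕ, ∀ᵐ x, x ∉ ({x | N + 1 / ((k:ℝ) + 1) ≤ distortionFn p D x} ∩ closedBall 0 R ∩ U) :=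
    fun k R => measure_eq_zero_iff_ae_notMem.1 (key _ (by
      have : 0 < 1 / ((k:ℝ) + 1) := by positivity
      linarith) R)
  filter_upwards [ae_all_iff.2 fun k => ae_all_iff.2 (h1 k)] with x hx hxU
  by_contra! hlt
  obtain ⟨k, hk⟩ := exists_nat_one_div_lt (sub_pos.2 hlt)
  obtain ⟨R, hR⟩ := exists_nat_ge ‖x‖
  refine hx k R ⟨⟨?_, by simpa using hR⟩, hxU⟩
  show N + 1 / ((k:ℝ) + 1) ≤ distortionFn p D x
  linarith

theorem GoodD.lower_lt (hg : GoodD φ D Ω S) (hn : 0 < n) (hΩ : IsOpen Ω)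
    (hcont : ContinuousOn φ Ω) (hinj : InjOn φ Ω) {Ω' U : Set 𝔼} (hΩ' : IsOpen Ω')
    (hmap : MapsTo φ Ω Ω') (hUo : IsOpen U) (hUΩ : U ⊆ Ω) (hV : IsOpen (φ '' U)) {p q N σ : ℝ}
    (hp : 0 < p) (hq : 0 < q) (hqp : q < p) (hσ : σ = (1 / q - 1 / p)⁻¹)
    (hT : TestH p q N φ Ω Ω' (φ '' U)) :
    ∫⁻ x in U, ENNReal.ofReal (distortionFn p D x) ^ σ ≤ ENNReal.ofReal N ^ σ := by
  have hKm := measurable_distortionFn hg.measD p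
  have hK0 := distortionFn_nonneg (D := D) p
  have hσ0' : 0 < 1 / q - 1 / p := sub_pos.2 (one_div_lt_one_div_of_lt hq hqp)
  have hσ0 : 0 < σ := by rw [hσ]; exact inv_pos.2 hσ0'
  have hσ1 : 1 / σ = 1 / q - 1 / p := by rw [hσ]; simp
  let k : ℕ → 𝔼 → ℝ := fun m => (closedBall (0:𝔼) m).indicator fun x => min (distortionFn p D x) m
  have hkm : ∀ m, Measurable (k m) := fun m =>
    (hKm.min measurable_const).indicator measurableSet_closedBall
  have hk0 : ∀ m x, 0 ≤ k m x := fun m x => indicator_nonneg (fun y _ => le_min (hK0 y) (by positivity)) x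
  have hkK : ∀ m x, k m x ≤ distortionFn p D x := by
    intro m x
    simp only [k]
    by_cases hx : x ∈ closedBall (0:𝔼) m
    · rw [indicator_of_mem hx]; exact min_le_left _ _
    · rw [indicator_of_notMem hx]; exact hK0 x
  have main : ∀ m, ∫⁻ x in U, ENNReal.ofReal (k m x) ^ σ ≤ ENNReal.ofReal N ^ σ := by
    intro m
    set W := ∫⁻ x in U, ENNReal.ofReal (k m x) ^ σ
    have hW : ∫⁻ x in U, ENNReal.ofReal (k m x ^ σ) = W := by
      simp only [W]
      congr 1; ext1 x
      rw [ENNReal.ofReal_rpow_of_nonneg (hk0 m x) hσ0.le]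
    have hWf : W ≠ ∞ := by
      have : W ≤ ENNReal.ofReal m ^ σ * volume (closedBall (0:𝔼) m) := by
        rw [← setLIntegral_const, ← lintegral_indicator measurableSet_closedBall]
        refine (setLIntegral_le_lintegral _ _).trans (lintegral_mono fun x => ?_)
        by_cases hx : x ∈ closedBall (0:𝔼) m
        · simp only [k]
          rw [indicator_of_mem hx, indicator_of_mem hx]
          gcongr
          exact min_le_right _ _
        · simp only [k]
          rw [indicator_of_notMem hx, indicator_of_notMem hx]
          simp [hσ0]
      exact ne_top_of_le_ne_top (ENNReal.mul_ne_top
        (ENNReal.rpow_ne_top_of_nonneg hσ0.le ENNReal.ofReal_ne_top) measure_closedBall_lt_top.ne) this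
    have h1 := hg.core hn hΩ hcont hinj hΩ' hmap hUo hUΩ hV hp hq hT (fun x => k m x ^ σ)
      ((hkm m).pow_const σ) (fun x => Real.rpow_nonneg (hk0 m x) _) (by rw [hW]; exact hWf)
    rw [hW] at h1
    have h2 : W ≤ ENNReal.ofReal N ^ q * W ^ (q / p) := by
      refine le_trans ?_ h1
      rw [← hW]
      refine lintegral_mono fun x => ENNReal.ofReal_le_ofReal ?_
      have hkx := hk0 m x
      calc k m x ^ σ = (k m x ^ (σ / p) * k m x) ^ q := by
            rw [← Real.rpow_add_one' hkx (by positivity), ← Real.rpow_mul hkx]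
            congr 1
            field_simp at hσ1
            field_simp
            nlinarith
        _ ≤ _ := by
            rw [← Real.rpow_mul hkx, mul_one_div]
            gcongr
            exact hkK m x
    by_cases hW0 : W = 0
    · rw [hW0]; exact zero_le
    have h3 : W ^ (q / σ) ≤ ENNReal.ofReal N ^ q := by
      have e : W = W ^ (q / σ) * W ^ (q / p) := by
        rw [← ENNReal.rpow_add _ _ hW0 hWf]
        have : q / σ + q / p = 1 := by
          have : q / σ = q * (1 / σ) := by ring
          rw [this, hσ1]; field_simp; ring
        rw [this, ENNReal.rpow_one]
      rw [e] at h2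
      refine (ENNReal.mul_le_mul_iff_left ?_ ?_).1 (by
        convert h2 using 1
        rw [← e])
      · exact (ENNReal.rpow_pos (pos_iff_ne_zero.2 hW0) hWf).ne'
      · exact ENNReal.rpow_ne_top_of_nonneg (by positivity) hWf
    have h4 := ENNReal.rpow_le_rpow h3 (show 0 ≤ σ / q by positivity)
    rw [← ENNReal.rpow_mul, ← ENNReal.rpow_mul, show q / σ * (σ / q) = 1 by field_simp,
      show q * (σ / q) = σ by field_simp, ENNReal.rpow_one] at h4
    exact h4
  have hlim : Tendsto (fun m => ∫⁻ x in U, ENNReal.ofReal (k m x) ^ σ) atTop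
      (𝓝 (∫⁻ x in U, ENNReal.ofReal (distortionFn p D x) ^ σ)) := by
    apply lintegral_tendsto_of_tendsto_of_monotone
    · intro m; exact ((hkm m).ennreal_ofReal.pow_const σ).aemeasurable
    · filter_upwards with x
      intro i j hij
      have : k i x ≤ k j x := by
        simp only [k]
        by_cases hx : x ∈ closedBall (0:𝔼) i
        · have hx' : x ∈ closedBall (0:𝔼) j := closedBall_subset_closedBall (by exact_mod_cast hij) hx
          rw [indicator_of_mem hx, indicator_of_mem hx']
          gcongr
        · rw [indicator_of_notMem hx]
          exact hk0 j x
      beta_reduce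
      gcongr
    · filter_upwards with x
      obtain ⟨R, hR⟩ := exists_nat_ge (max ‖x‖ (distortionFn p D x))
      apply tendsto_const_nhds.congr'
      filter_upwards [eventually_ge_atTop R] with i hi
      have hi' : (R:ℝ) ≤ i := by exact_mod_cast hi
      have hx : x ∈ closedBall (0:𝔼) i := by
        simpa using (le_max_left _ _).trans (hR.trans hi')
      simp only [k]
      rw [indicator_of_mem hx, min_eq_left ((le_max_right _ _).trans (hR.trans hi'))]
  exact le_of_tendsto' hlim main

end PartNine

section PartTen
variable {n : ℕ}
local notation "𝔼" => EuclideanSpace ℝ (Fin n)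
variable {φ : EuclideanSpace ℝ (Fin n) → EuclideanSpace ℝ (Fin n)}
  {D : EuclideanSpace ℝ (Fin n) → EuclideanSpace ℝ (Fin n) →L[ℝ] EuclideanSpace ℝ (Fin n)}
  {Ω : Set (EuclideanSpace ℝ (Fin n))} {S : ℕ → Set (EuclideanSpace ℝ (Fin n))}

theorem LocLipschitzOn.ae_diff {u : 𝔼 → ℝ} {Ω' : Set 𝔼} (hΩ' : IsOpen Ω')
    (hu : LocLipschitzOn u Ω') : volume {y | y ∈ Ω' ∧ ¬ DifferentiableAt ℝ u y} = 0 := by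
  refine measure_null_of_locally_null _ ?_
  rintro x ⟨hx, -⟩
  obtain ⟨ε, hε, h⟩ := Metric.nhds_basis_closedBall.mem_iff.1 (hΩ'.mem_nhds hx)
  obtain ⟨C, hC⟩ := hu _ h (isCompact_closedBall x ε)
  have hC' := hC.mono (ball_subset_closedBall)
  have hae := hC'.ae_differentiableWithinAt_of_mem (μ := volume)
  refine ⟨ball x ε ∩ {y | y ∈ Ω' ∧ ¬ DifferentiableAt ℝ u y},
    inter_mem (mem_nhdsWithin_of_mem_nhds (ball_mem_nhds x hε)) self_mem_nhdsWithin, ?_⟩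
  refine measure_mono_null ?_ (ae_iff.1 hae)
  rintro y ⟨hy, -, hy2⟩ h3
  exact hy2 ((h3 hy).differentiableAt (isOpen_ball.mem_nhds hy))

theorem GoodD.chain (hg : GoodD φ D Ω S) (hn : 0 < n) (hΩ : IsOpen Ω)
    (hcont : ContinuousOn φ Ω) (hinj : InjOn φ Ω) {Ω' : Set 𝔼} (hΩ' : IsOpen Ω')
    (hmap : MapsTo φ Ω Ω') {p : ℝ} (hp : 0 < p)
    (hz : ∀ᵐ x, x ∈ Ω → (D x).det = 0 → D x = 0)
    {u : 𝔼 → ℝ} {v : 𝔼 → 𝔼} (hu : LocLipschitzOn u Ω') (hw : HasWeakGradOn (u ∘ φ) v Ω) :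
    ∀ᵐ x, x ∈ Ω →
      ‖v x‖ ≤ distortionFn p D x * (|(D x).det| ^ (1 / p) * ‖gradient u (φ x)‖) := by
  classical
  have hA := adiff_of_weakGrad (u ∘ φ) v Ω hΩ ((hu.continuousOn hΩ').comp hcont hmap) hw
  have hφm : Measurable (Ω.piecewise φ 0) :=
    hcont.measurable_piecewise continuousOn_const hΩ.measurableSet
  have hφe : ∀ x ∈ Ω, Ω.piecewise φ 0 x = φ x := fun x hx => piecewise_eq_of_mem _ _ _ hx
  have hdm : MeasurableSet {y | DifferentiableAt ℝ u y} := measurableSet_of_differentiableAt ℝ u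
  have hTm : ∀ m, MeasurableSet {x | x ∈ S m ∧ DifferentiableAt ℝ u (φ x)} := by
    intro m
    have : {x | x ∈ S m ∧ DifferentiableAt ℝ u (φ x)} =
        S m ∩ (Ω.piecewise φ 0) ⁻¹' {y | DifferentiableAt ℝ u y} := by
      ext x
      simp only [mem_ofPred_eq, mem_inter_iff, mem_preimage]
      exact and_congr_right fun hx => by rw [hφe x (hg.sub m hx)]
    rw [this]
    exact (hg.meas m).inter (hφm hdm)
  have hEm : ∀ m, MeasurableSet {x | x ∈ S m ∧ ¬ DifferentiableAt ℝ u (φ x)} := by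
    intro m
    have : {x | x ∈ S m ∧ ¬ DifferentiableAt ℝ u (φ x)} =
        S m \ {x | x ∈ S m ∧ DifferentiableAt ℝ u (φ x)} := by
      ext x
      simp only [mem_ofPred_eq, Set.mem_sdiff]; tauto
    rw [this]
    exact (hg.meas m).diff (hTm m)
  have h1 : ∀ m, ∀ᵐ x, x ∈ {x | x ∈ S m ∧ DifferentiableAt ℝ u (φ x)} →
      ‖v x‖ ≤ ‖D x‖ * ‖gradient u (φ x)‖ := by
    intro m
    have := hA.unique hn _ (hTm m) (fun x => (fderiv ℝ u (φ x)) ∘L D x) (u ∘ φ)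
      (fun _ _ => rfl) (by
        rintro x ⟨hx, hd⟩
        exact hd.hasFDerivAt.comp_hasFDerivWithinAt x
          ((hg.deriv m x hx).mono (fun y hy => hy.1)))
    filter_upwards [this] with x hx hxT
    have hx := congrArg norm (hx ⟨hxT, hg.sub m hxT.1⟩)
    rw [LinearIsometryEquiv.norm_map] at hx
    rw [hx, norm_gradient, mul_comm]
    exact ContinuousLinearMap.opNorm_comp_le _ _
  have h2 : ∀ m, ∀ᵐ x, x ∈ {x | x ∈ S m ∧ D x = 0} → v x = 0 := by
    intro m
    have hm : MeasurableSet {x | x ∈ S m ∧ D x = 0} :=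
      (hg.meas m).inter (hg.measD (measurableSet_singleton 0))
    have := hA.unique hn _ hm (fun x => 0) (u ∘ φ) (fun _ _ => rfl) (by
        rintro x ⟨hx, hd⟩
        have h0 := (hg.deriv m x hx).mono (s := {x | x ∈ S m ∧ D x = 0}) (fun y hy => hy.1)
        have hcw := h0.continuousWithinAt
        rw [hd] at h0
        have h0 := h0.isLittleO
        obtain ⟨ε, hε, h⟩ := Metric.nhds_basis_closedBall.mem_iff.1
          (hΩ'.mem_nhds (hmap (hg.sub m hx)))
        obtain ⟨C, hC⟩ := hu _ h (isCompact_closedBall _ ε)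
        refine HasFDerivWithinAt.of_isLittleO ?_
        refine Asymptotics.IsBigO.trans_isLittleO ?_ h0
        refine Asymptotics.IsBigO.of_bound C ?_
        filter_upwards [hcw (closedBall_mem_nhds _ hε)] with y hy
        have := hC.dist_le_mul _ hy _ (mem_closedBall_self hε.le)
        simpa [dist_eq_norm] using this)
    filter_upwards [this] with x hx hxT
    have hx := hx ⟨hxT, hg.sub m hxT.1⟩
    simpa using hx
  have h3 : ∀ m, ∀ᵐ x, x ∈ {x | x ∈ S m ∧ ¬ DifferentiableAt ℝ u (φ x)} → (D x).det = 0 := by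
    intro m
    have hvi := hg.volume_image hinj _ (hEm m) (fun x hx => mem_iUnion.2 ⟨m, hx.1⟩)
    have h0 : volume (φ '' {x | x ∈ S m ∧ ¬ DifferentiableAt ℝ u (φ x)}) = 0 := by
      refine measure_mono_null ?_ (hu.ae_diff hΩ')
      rintro _ ⟨x, hx, rfl⟩
      exact ⟨hmap (hg.sub m hx.1), hx.2⟩
    rw [h0, eq_comm, lintegral_eq_zero_iff (by
      have := measurable_det hg.measD
      fun_prop)] at hvi
    have := (ae_restrict_iff' (hEm m)).1 hvi
    filter_upwards [this] with x hx hxE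
    have := hx hxE
    simpa using this
  filter_upwards [hg.ae_mem, hz, ae_all_iff.2 h1, ae_all_iff.2 h2, ae_all_iff.2 h3]
    with x hm hz h1 h2 h3 hx
  obtain ⟨m, hm⟩ := mem_iUnion.1 (hm hx)
  by_cases hJ : (D x).det = 0
  · rw [h2 m ⟨hm, hz hx hJ⟩, norm_zero]
    have := distortionFn_nonneg (D := D) p x
    positivity
  · have hd : DifferentiableAt ℝ u (φ x) := by
      by_contra hc
      exact hJ (h3 m ⟨hm, hc⟩)
    rw [distortionFn_of_det_ne_zero p x hJ]
    have : 0 < |(D x).det| ^ (1 / p) := Real.rpow_pos_of_pos (abs_pos.2 hJ) _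
    rw [← mul_assoc, div_mul_cancel₀ _ this.ne']
    exact h1 m ⟨hm, hd⟩

theorem vanish_outside (hn : 0 < n) (hΩ : IsOpen Ω)
    (hcont : ContinuousOn φ Ω) (hinj : InjOn φ Ω) {Ω' U : Set 𝔼} (hΩ' : IsOpen Ω')
    (hmap : MapsTo φ Ω Ω') (hUo : IsOpen U) (hUΩ : U ⊆ Ω)
    {u : 𝔼 → ℝ} {v : 𝔼 → 𝔼} (hu : LocLipschitzOn u Ω') (hu0 : ∀ y ∈ Ω' \ φ '' U, u y = 0)
    (hw : HasWeakGradOn (u ∘ φ) v Ω) : ∀ᵐ x, x ∈ Ω \ U → v x = 0 := by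
  have hA := adiff_of_weakGrad (u ∘ φ) v Ω hΩ ((hu.continuousOn hΩ').comp hcont hmap) hw
  have := hA.unique hn (Ω \ U) (hΩ.measurableSet.diff hUo.measurableSet) (fun _ => 0)
    (fun _ => 0) (by
      rintro x ⟨hx, hxU⟩
      refine hu0 _ ⟨hmap hx, ?_⟩
      rintro ⟨y, hy, hyx⟩
      exact hxU (hinj (hUΩ hy) hx hyx ▸ hy)) (fun x _ => hasFDerivWithinAt_const _ _ _)
  filter_upwards [this] with x hx hxT
  simpa using hx ⟨hxT, hxT.1⟩

theorem holder_sigma {p q : ℝ} (hq : 0 < q) (hqp : q ≤ p) :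
    ENNReal.HolderTriple (sigmaExp p q) (ENNReal.ofReal p) (ENNReal.ofReal q) := by
  have hp := hq.trans_le hqp
  constructor
  unfold sigmaExp
  split_ifs with h
  · simp [h]
  · have hlt : q < p := lt_of_le_of_ne hqp h
    have h0 : 0 < 1 / q - 1 / p := sub_pos.2 (one_div_lt_one_div_of_lt hq hlt)
    rw [← ENNReal.ofReal_inv_of_pos (by positivity), ← ENNReal.ofReal_inv_of_pos hp,
      ← ENNReal.ofReal_inv_of_pos hq, ← ENNReal.ofReal_add (by positivity) (by positivity)]
    congr 1
    simp

theorem eLpNorm_realExp {F : Type*} [NormedAddCommGroup F] {p : ℝ} (hp : 0 < p) (f : 𝔼 → F)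
    (μ : Measure 𝔼) : eLpNorm f (ENNReal.ofReal p) μ = (∫⁻ x, ‖f x‖ₑ ^ p ∂μ) ^ (1 / p) := by
  rw [eLpNorm_eq_lintegral_rpow_enorm_toReal (by simpa using hp) (by simp),
    ENNReal.toReal_ofReal hp.le]

theorem GoodD.upper (hg : GoodD φ D Ω S) (hn : 0 < n) (hΩ : IsOpen Ω)
    (hcont : ContinuousOn φ Ω) (hinj : InjOn φ Ω) {Ω' U : Set 𝔼} (hΩ' : IsOpen Ω')
    (hmap : MapsTo φ Ω Ω') (hUo : IsOpen U) (hUΩ : U ⊆ Ω) {p q : ℝ} (hq : 0 < q) (hqp : q ≤ p)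
    (hz : ∀ᵐ x, x ∈ Ω → (D x).det = 0 → D x = 0)
    {u : 𝔼 → ℝ} {v : 𝔼 → 𝔼} (hu : LocLipschitzOn u Ω') (hu0 : ∀ y ∈ Ω' \ φ '' U, u y = 0)
    (hw : HasWeakGradOn (u ∘ φ) v Ω) :
    eLpNorm v (ENNReal.ofReal q) (volume.restrict Ω) ≤
      eLpNorm (distortionFn p D) (sigmaExp p q) (volume.restrict U) *
        (∫⁻ y in Ω', ‖gradient u y‖ₑ ^ p) ^ (1 / p) := by
  classical
  have hp := hq.trans_le hqp
  have hv0 := vanish_outside hn hΩ hcont hinj hΩ' hmap hUo hUΩ hu hu0 hw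
  have hch := hg.chain hn hΩ hcont hinj hΩ' hmap hp hz hu hw
  have hφm : Measurable (Ω.piecewise φ 0) :=
    hcont.measurable_piecewise continuousOn_const hΩ.measurableSet
  have hφe : ∀ x ∈ Ω, Ω.piecewise φ 0 x = φ x := fun x hx => piecewise_eq_of_mem _ _ _ hx
  have hJm := measurable_det hg.measD
  let w : 𝔼 → ℝ := fun x => |(D x).det| ^ (1 / p) * ‖gradient u (Ω.piecewise φ 0 x)‖
  have hwm : Measurable w := by
    have := ((measurable_gradient u).comp hφm).norm
    exact (hJm.abs.pow_const (1/p)).mul this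
  have e1 : eLpNorm v (ENNReal.ofReal q) (volume.restrict Ω) =
      eLpNorm v (ENNReal.ofReal q) (volume.restrict U) := by
    rw [← eLpNorm_indicator_eq_eLpNorm_restrict (μ := volume) hΩ.measurableSet,
      ← eLpNorm_indicator_eq_eLpNorm_restrict (μ := volume) hUo.measurableSet]
    apply eLpNorm_congr_ae
    filter_upwards [hv0] with x hx
    by_cases hxU : x ∈ U
    · rw [indicator_of_mem hxU, indicator_of_mem (hUΩ hxU)]
    · by_cases hxΩ : x ∈ Ω
      · rw [indicator_of_notMem hxU, indicator_of_mem hxΩ, hx ⟨hxΩ, hxU⟩]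
      · rw [indicator_of_notMem hxU, indicator_of_notMem hxΩ]
  have e2 : eLpNorm v (ENNReal.ofReal q) (volume.restrict U) ≤
      eLpNorm (distortionFn p D • w) (ENNReal.ofReal q) (volume.restrict U) := by
    apply eLpNorm_mono_ae
    rw [ae_restrict_iff' hUo.measurableSet]
    filter_upwards [hch] with x hx hxU
    refine (hx (hUΩ hxU)).trans ?_
    rw [← hφe x (hUΩ hxU)]
    exact Real.le_norm_self _
  have := holder_sigma hq hqp
  have e3 := eLpNorm_smul_le_mul_eLpNorm (p := sigmaExp p q) (q := ENNReal.ofReal p)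
    (r := ENNReal.ofReal q) (μ := volume.restrict U)
    hwm.aestronglyMeasurable (measurable_distortionFn hg.measD p).aestronglyMeasurable
  rw [e1]
  refine e2.trans (e3.trans (mul_le_mul_right ?_ _))
  rw [eLpNorm_realExp hp]
  refine ENNReal.rpow_le_rpow ?_ (by positivity)
  have hal := hg.area_le hinj U hUo.measurableSet hUΩ (fun y => ‖gradient u y‖ₑ ^ p)
  refine le_trans (le_of_eq ?_) (hal.trans (lintegral_mono_set (image_subset_iff.2 fun x hx => hmap (hUΩ hx))))
  refine setLIntegral_congr_fun hUo.measurableSet fun x hx => ?_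
  show ‖|(D x).det| ^ (1 / p) * ‖gradient u (Ω.piecewise φ 0 x)‖‖ₑ ^ p = _
  rw [hφe x (hUΩ hx), enorm_mul, ENNReal.mul_rpow_of_nonneg _ _ hp.le, enorm_norm,
    Real.enorm_of_nonneg (by positivity), ENNReal.ofReal_rpow_of_nonneg (by positivity) hp.le,
    ← Real.rpow_mul (abs_nonneg _), one_div_mul_cancel hp.ne', Real.rpow_one]

end PartTen

section PartEleven
variable {n : ℕ}
local notation "𝔼" => EuclideanSpace ℝ (Fin n)
variable {φ : EuclideanSpace ℝ (Fin n) → EuclideanSpace ℝ (Fin n)}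
  {D : EuclideanSpace ℝ (Fin n) → EuclideanSpace ℝ (Fin n) →L[ℝ] EuclideanSpace ℝ (Fin n)}
  {Ω : Set (EuclideanSpace ℝ (Fin n))} {S : ℕ → Set (EuclideanSpace ℝ (Fin n))}

theorem lint_eq_ofReal {p : ℝ} (hp : 0 < p) {g : 𝔼 → 𝔼} {Ω : Set 𝔼}
    (hi : IntegrableOn (fun x => ‖g x‖ ^ p) Ω volume) :
    ∫⁻ x in Ω, ‖g x‖ₑ ^ p = ENNReal.ofReal (∫ x in Ω, ‖g x‖ ^ p) := by
  rw [ofReal_integral_eq_lintegral_ofReal hi (ae_of_all _ fun x => by positivity)]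
  congr 1; ext1 x
  rw [← ofReal_norm, ENNReal.ofReal_rpow_of_nonneg (norm_nonneg _) hp.le]

theorem lint_rpow_eq_ofReal {p : ℝ} (hp : 0 < p) {g : 𝔼 → 𝔼} {Ω : Set 𝔼}
    (hi : IntegrableOn (fun x => ‖g x‖ ^ p) Ω volume) :
    (∫⁻ x in Ω, ‖g x‖ₑ ^ p) ^ (1 / p) = ENNReal.ofReal ((∫ x in Ω, ‖g x‖ ^ p) ^ (1 / p)) := by
  rw [lint_eq_ofReal hp hi, ENNReal.ofReal_rpow_of_nonneg
    (integral_nonneg fun x => by positivity) (by positivity)]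

theorem testH_bound {p q N : ℝ} (hp : 0 < p) (hq : 0 < q) (hN : 0 ≤ N) {g v : 𝔼 → 𝔼} {Ω Ω' : Set 𝔼}
    (hi : IntegrableOn (fun x => ‖g x‖ ^ p) Ω' volume)
    (hv : IntegrableOn (fun x => ‖v x‖ ^ q) Ω volume)
    (h : (∫ x in Ω, ‖v x‖ ^ q) ^ (1/q) ≤ N * (∫ x in Ω', ‖g x‖ ^ p) ^ (1/p)) :
    ∫⁻ x in Ω, ‖v x‖ₑ ^ q ≤ ENNReal.ofReal N ^ q * (∫⁻ x in Ω', ‖g x‖ₑ ^ p) ^ (q / p) := by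
  have h1 := ENNReal.ofReal_le_ofReal h
  rw [ENNReal.ofReal_mul hN, ← lint_rpow_eq_ofReal hp hi, ← lint_rpow_eq_ofReal hq hv] at h1
  have h2 := ENNReal.rpow_le_rpow h1 hq.le
  rw [← ENNReal.rpow_mul, one_div_mul_cancel hq.ne', ENNReal.rpow_one,
    ENNReal.mul_rpow_of_nonneg _ _ hq.le, ← ENNReal.rpow_mul, one_div_mul_eq_div] at h2
  exact h2

theorem CompBound.testH {p q K : ℝ} (hp : 0 < p) (hq : 0 < q) (hK : 0 ≤ K) {Ω' : Set 𝔼}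
    (h : CompBound p q K φ Ω Ω') (V : Set 𝔼) : TestH p q K φ Ω Ω' V := by
  intro u hu _ hi
  obtain ⟨v, hw, hv, hb⟩ := h u hu hi
  exact ⟨v, hw, testH_bound hp hq hK hi hv hb⟩

theorem eLpNorm_sigma_pow {p q : ℝ} (hq : 0 < q) (hqp : q < p) (U : Set 𝔼) :
    eLpNorm (distortionFn p D) (sigmaExp p q) (volume.restrict U) =
      (∫⁻ x in U, ENNReal.ofReal (distortionFn p D x) ^ ((1 / q - 1 / p)⁻¹)) ^
        (1 / (1 / q - 1 / p)⁻¹) := by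
  have h0 : 0 < 1 / q - 1 / p := sub_pos.2 (one_div_lt_one_div_of_lt hq hqp)
  rw [sigmaExp, if_neg hqp.ne, one_div (1 / q - 1 / p), eLpNorm_realExp (by positivity)]
  congr 2; ext1 x
  rw [Real.enorm_of_nonneg (distortionFn_nonneg p x)]

theorem GoodD.lower (hg : GoodD φ D Ω S) (hn : 0 < n) (hΩ : IsOpen Ω)
    (hcont : ContinuousOn φ Ω) (hinj : InjOn φ Ω) {Ω' U : Set 𝔼} (hΩ' : IsOpen Ω')
    (hmap : MapsTo φ Ω Ω') (hUo : IsOpen U) (hUΩ : U ⊆ Ω) (hV : IsOpen (φ '' U)) {p q N : ℝ}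
    (hq : 0 < q) (hqp : q ≤ p) (hN : 0 ≤ N)
    (hT : TestH p q N φ Ω Ω' (φ '' U)) :
    eLpNorm (distortionFn p D) (sigmaExp p q) (volume.restrict U) ≤ ENNReal.ofReal N := by
  have hp := hq.trans_le hqp
  rcases hqp.eq_or_lt with rfl | hlt
  · have := hg.lower_eq hn hΩ hcont hinj hΩ' hmap hUo hUΩ hV hp hN hT
    rw [sigmaExp, if_pos rfl, eLpNorm_exponent_top]
    apply eLpNormEssSup_le_of_ae_bound
    rw [ae_restrict_iff' hUo.measurableSet]
    filter_upwards [this] with x hx hxU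
    rw [Real.norm_of_nonneg (distortionFn_nonneg _ x)]
    exact hx hxU
  · have := hg.lower_lt hn hΩ hcont hinj hΩ' hmap hUo hUΩ hV hp hq hlt rfl hT
    have h0 : 0 < 1 / q - 1 / p := sub_pos.2 (one_div_lt_one_div_of_lt hq hlt)
    rw [eLpNorm_sigma_pow hq hlt]
    refine (ENNReal.rpow_le_rpow this (by positivity)).trans (le_of_eq ?_)
    rw [← ENNReal.rpow_mul, mul_one_div_cancel (by positivity), ENNReal.rpow_one]

theorem main_good (hg : GoodD φ D Ω S) (hn : 0 < n) (hΩ : IsOpen Ω)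
    (hcont : ContinuousOn φ Ω) {Ω' : Set 𝔼} (hbij : BijOn φ Ω Ω') (hΩ' : IsOpen Ω')
    (hopen : ∀ U : Set 𝔼, IsOpen U → U ⊆ Ω → IsOpen (φ '' U))
    {p q : ℝ} (hq : 0 < q) (hqp : q ≤ p)
    (hbd : ∃ K : ℝ, 0 ≤ K ∧ CompBound p q K φ Ω Ω') :
    (q < p → ∀ U : Set 𝔼, IsOpen U → U ⊆ Ω →
      ∫ x in U, distortionFn p D x ^ ((1/q - 1/p)⁻¹) =
        PhiPQ p q ((1/q - 1/p)⁻¹) φ Ω Ω' (φ '' U)) ∧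
    (eLpNorm (distortionFn p D) (sigmaExp p q) (volume.restrict Ω)).toReal =
      sInf {K : ℝ | 0 ≤ K ∧ CompBound p q K φ Ω Ω'} := by
  have hp := hq.trans_le hqp
  have hinj := hbij.injOn
  have hmap := hbij.mapsTo
  have hbd' := hbd
  obtain ⟨K₀, hK₀, hCB⟩ := hbd
  have hz : ∀ᵐ x, x ∈ Ω → (D x).det = 0 → D x = 0 :=
    hg.deriv_zero hn hΩ hcont hinj hΩ' hmap hΩ subset_rfl (hopen Ω hΩ subset_rfl) hp hq
      (hCB.testH hp hq hK₀ _)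
  have hlow : ∀ U : Set 𝔼, IsOpen U → U ⊆ Ω → ∀ N, 0 ≤ N → TestH p q N φ Ω Ω' (φ '' U) →
      eLpNorm (distortionFn p D) (sigmaExp p q) (volume.restrict U) ≤ ENNReal.ofReal N :=
    fun U hU hUΩ N hN hT => hg.lower hn hΩ hcont hinj hΩ' hmap hU hUΩ (hopen U hU hUΩ) hq hqp hN hT
  have hfin : ∀ U : Set 𝔼, IsOpen U → U ⊆ Ω →
      eLpNorm (distortionFn p D) (sigmaExp p q) (volume.restrict U) ≠ ⊤ := fun U hU hUΩ =>
    ((hlow U hU hUΩ K₀ hK₀ (hCB.testH hp hq hK₀ _)).trans_lt ENNReal.ofReal_lt_top).ne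
  have hup : ∀ U : Set 𝔼, IsOpen U → U ⊆ Ω → ∀ (u : 𝔼 → ℝ) (v : 𝔼 → 𝔼), LocLipschitzOn u Ω' →
      (∀ y ∈ Ω' \ φ '' U, u y = 0) → IntegrableOn (fun x => ‖gradient u x‖ ^ p) Ω' volume →
      HasWeakGradOn (u ∘ φ) v Ω → IntegrableOn (fun x => ‖v x‖ ^ q) Ω volume →
      (∫ x in Ω, ‖v x‖ ^ q) ^ (1/q) ≤
        (eLpNorm (distortionFn p D) (sigmaExp p q) (volume.restrict U)).toReal *
          (∫ x in Ω', ‖gradient u x‖ ^ p) ^ (1/p) := by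
    intro U hU hUΩ u v hu hu0 hi hw hv
    have := hg.upper hn hΩ hcont hinj hΩ' hmap hU hUΩ hq hqp hz hu hu0 hw
    rw [eLpNorm_realExp hq, lint_rpow_eq_ofReal hq hv, lint_rpow_eq_ofReal hp hi] at this
    have h2 := ENNReal.toReal_mono (ENNReal.mul_ne_top (hfin U hU hUΩ) ENNReal.ofReal_ne_top) this
    rw [ENNReal.toReal_mul] at h2
    have e : ∀ (Ω : Set 𝔼) (g : 𝔼 → 𝔼) (r s : ℝ), 0 ≤ (∫ x in Ω, ‖g x‖ ^ r) ^ s := fun Ω g r s =>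
      Real.rpow_nonneg (integral_nonneg fun x => by positivity) _
    rwa [ENNReal.toReal_ofReal (e _ _ _ _), ENNReal.toReal_ofReal (e _ _ _ _)] at h2
  constructor
  · intro hlt U hU hUΩ
    have h0 : 0 < 1 / q - 1 / p := sub_pos.2 (one_div_lt_one_div_of_lt hq hlt)
    set C := eLpNorm (distortionFn p D) (sigmaExp p q) (volume.restrict U) with hC
    have hCfin : C ≠ ⊤ := hfin U hU hUΩ
    have hint : ∫ x in U, distortionFn p D x ^ ((1/q - 1/p)⁻¹) = C.toReal ^ ((1/q - 1/p)⁻¹) := by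
      rw [integral_eq_lintegral_of_nonneg_ae
        (ae_of_all _ fun x => Real.rpow_nonneg (distortionFn_nonneg p x) _)
        ((measurable_distortionFn hg.measD p).pow_const _).aestronglyMeasurable]
      rw [ENNReal.toReal_rpow, hC, eLpNorm_sigma_pow hq hlt, ← ENNReal.rpow_mul,
        one_div_mul_cancel (by positivity), ENNReal.rpow_one]
      congr 2; ext1 x
      rw [ENNReal.ofReal_rpow_of_nonneg (distortionFn_nonneg p x) (by positivity)]
    rw [hint, PhiPQ]
    congr 1
    set s := {r : ℝ | ∃ (u : 𝔼 → ℝ) (v : 𝔼 → 𝔼),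
      LocLipschitzOn u Ω' ∧ (∀ y ∈ Ω' \ φ '' U, u y = 0) ∧
      IntegrableOn (fun x => ‖gradient u x‖ ^ p) Ω' volume ∧
      (0 < ∫ x in Ω', ‖gradient u x‖ ^ p) ∧
      HasWeakGradOn (u ∘ φ) v Ω ∧ IntegrableOn (fun x => ‖v x‖ ^ q) Ω volume ∧
      r = (∫ x in Ω, ‖v x‖ ^ q) ^ (1/q) / (∫ x in Ω', ‖gradient u x‖ ^ p) ^ (1/p)} with hs
    have hsle : ∀ r ∈ s, r ≤ C.toReal := by
      rintro r ⟨u, v, hu, hu0, hi, hpos, hw, hv, rfl⟩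
      rw [div_le_iff₀ (Real.rpow_pos_of_pos hpos _)]
      exact hup U hU hUΩ u v hu hu0 hi hw hv
    have hs0 : 0 ≤ sSup s := by
      refine Real.sSup_nonneg ?_
      rintro r ⟨u, v, hu, hu0, hi, hpos, hw, hv, rfl⟩
      exact div_nonneg (Real.rpow_nonneg (integral_nonneg fun x => by positivity) _)
        (Real.rpow_nonneg hpos.le _)
    refine le_antisymm ?_ (Real.sSup_le hsle ENNReal.toReal_nonneg)
    refine ENNReal.toReal_le_of_le_ofReal hs0 (hlow U hU hUΩ _ hs0 ?_)
    intro u hu hu0 hi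
    obtain ⟨v, hw, hv, hb⟩ := hCB u hu hi
    refine ⟨v, hw, testH_bound hp hq hs0 hi hv ?_⟩
    have hnn : 0 ≤ ∫ x in Ω', ‖gradient u x‖ ^ p := integral_nonneg fun x => by positivity
    rcases hnn.eq_or_lt with he | hpos
    · rw [← he, Real.zero_rpow (by positivity), mul_zero] at hb ⊢
      exact hb
    · rw [← div_le_iff₀ (Real.rpow_pos_of_pos hpos _)]
      exact le_csSup ⟨_, hsle⟩ ⟨u, v, hu, hu0, hi, hpos, hw, hv, rfl⟩
  · apply le_antisymm
    · refine le_csInf hbd' ?_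
      rintro K ⟨hK, hC⟩
      exact ENNReal.toReal_le_of_le_ofReal hK
        (hlow Ω hΩ subset_rfl K hK (hC.testH hp hq hK _))
    · refine csInf_le ⟨0, fun K hK => hK.1⟩ ⟨ENNReal.toReal_nonneg, ?_⟩
      intro u hu hi
      obtain ⟨v, hw, hv, hb⟩ := hCB u hu hi
      refine ⟨v, hw, hv, hup Ω hΩ subset_rfl u v hu ?_ hi hw hv⟩
      rw [hbij.image_eq]
      simp

theorem main_final
    {n : ℕ} (hn : 0 < n)
    (Ω Ω' : Set (EuclideanSpace ℝ (Fin n)))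
    (hΩo : IsOpen Ω) (hΩ'o : IsOpen Ω')
    (p q : ℝ) (hq : 1 ≤ q) (hqp : q ≤ p)
    (φ : EuclideanSpace ℝ (Fin n) → EuclideanSpace ℝ (Fin n))
    (hbij : Set.BijOn φ Ω Ω') (hcont : ContinuousOn φ Ω)
    (hopen : ∀ U : Set (EuclideanSpace ℝ (Fin n)), IsOpen U → U ⊆ Ω → IsOpen (φ '' U))
    (hbd : ∃ K : ℝ, 0 ≤ K ∧ CompBound p q K φ Ω Ω')
    (D : EuclideanSpace ℝ (Fin n) →
      (EuclideanSpace ℝ (Fin n) →L[ℝ] EuclideanSpace ℝ (Fin n)))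
    (hD : IsWeakJacobian φ D Ω) :
    (q < p → ∀ U : Set (EuclideanSpace ℝ (Fin n)), IsOpen U → U ⊆ Ω →
      ∫ x in U, distortionFn p D x ^ ((1/q - 1/p)⁻¹) =
        PhiPQ p q ((1/q - 1/p)⁻¹) φ Ω Ω' (φ '' U)) ∧
    (eLpNorm (distortionFn p D) (sigmaExp p q) (volume.restrict Ω)).toReal =
      sInf {K : ℝ | 0 ≤ K ∧ CompBound p q K φ Ω Ω'} := by
  obtain ⟨D', S, hg, hae⟩ := exists_good φ D Ω hΩo hcont hD
  have hdd : ∀ᵐ x ∂(volume.restrict Ω), distortionFn p D x = distortionFn p D' x := by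
    filter_upwards [hae] with x hx
    simp only [distortionFn, hx]
  obtain ⟨h1, h2⟩ := main_good hg hn hΩo hcont hbij hΩ'o hopen (zero_lt_one.trans_le hq) hqp hbd
  refine ⟨fun hlt U hU hUΩ => ?_, ?_⟩
  · rw [← h1 hlt U hU hUΩ]
    apply integral_congr_ae
    filter_upwards [ae_restrict_of_ae_restrict_of_subset hUΩ hdd] with x hx
    rw [hx]
  · rw [← h2, eLpNorm_congr_ae hdd]

end PartEleven

end HelperParts

/-- For a homeomorphism inducing a bounded composition operator, the integral
of `K_p(·,φ)^σ` over an open `U ⊆ Ω` equals `Φ_{p,q}(φ(U))` (when `q < p`), and the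
`L_σ`-norm of `K_p(·,φ)` equals the operator norm for all `1 ≤ q ≤ p < ∞`. -/
theorem distortion_integral_eq_Phi
    {n : ℕ} (hn : 0 < n)
    (Ω Ω' : Set (EuclideanSpace ℝ (Fin n)))
    (hΩo : IsOpen Ω) (hΩc : IsConnected Ω) (hΩ'o : IsOpen Ω') (hΩ'c : IsConnected Ω')
    (p q : ℝ) (hq : 1 ≤ q) (hqp : q ≤ p)
    (φ : EuclideanSpace ℝ (Fin n) → EuclideanSpace ℝ (Fin n))
    (hbij : Set.BijOn φ Ω Ω') (hcont : ContinuousOn φ Ω)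
    (hopen : ∀ U : Set (EuclideanSpace ℝ (Fin n)), IsOpen U → U ⊆ Ω → IsOpen (φ '' U))
    (hbd : ∃ K : ℝ, 0 ≤ K ∧ CompBound p q K φ Ω Ω')
    (D : EuclideanSpace ℝ (Fin n) →
      (EuclideanSpace ℝ (Fin n) →L[ℝ] EuclideanSpace ℝ (Fin n)))
    (hD : IsWeakJacobian φ D Ω)
    (hDq : ∀ Kc : Set (EuclideanSpace ℝ (Fin n)), Kc ⊆ Ω → IsCompact Kc →
      IntegrableOn (fun x => ‖D x‖ ^ q) Kc volume) :
    (q < p → ∀ U : Set (EuclideanSpace ℝ (Fin n)), IsOpen U → U ⊆ Ω →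
      ∫ x in U, distortionFn p D x ^ ((1/q - 1/p)⁻¹) =
        PhiPQ p q ((1/q - 1/p)⁻¹) φ Ω Ω' (φ '' U)) ∧
    (eLpNorm (distortionFn p D) (sigmaExp p q) (volume.restrict Ω)).toReal =
      sInf {K : ℝ | 0 ≤ K ∧ CompBound p q K φ Ω Ω'} := by
  exact main_final hn Ω Ω' hΩo hΩ'o p q hq hqp φ hbij hcont hopen hbd D hD
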